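/- arXiv:1409.5661 — 5 statements merged into one kernel-verified Lean document; each statement's English description precedes it below -/
import Mathlib

section
/- Every sum-free set S ⊆ [n] satisfies at least one of the following conditions: (i) |S| ≤ 2n/5 + 1; (ii) every element of S is odd; (iii) S is empty or |S| ≤ min(S), where min(S) is the least element of S. -/
/-- A set of naturals is sum-free: no `x, y ∈ S` (not necessarily distinct) with `x + y ∈ S`. -/
def SumFree (S : Finset ℕ) : Prop := ∀ x ∈ S, ∀ y ∈ S, x + y ∉ S

section SumFreeStructure

open Finset
open scoped Pointwise

section Isoperimetric

variable {G : Type*} [AddCommGroup G] [Fintype G] [DecidableEq G]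

/-- An atom of `B`, if no larger than the atoms of `-B`, is contained in every fragment
that it meets. -/
lemma atom_subset_fragment {B M F : Finset G} {κ : ℕ}
    (hκ : ∀ X : Finset G, X.Nonempty → X + B ≠ univ → X.card + κ ≤ (X + B).card)
    (hMB : M + B ≠ univ) (hMκ : (M + B).card = M.card + κ)
    (hmin : ∀ X : Finset G, X.Nonempty → X + B ≠ univ → (X + B).card = X.card + κ →
      M.card ≤ X.card)
    (hmin' : ∀ X : Finset G, X.Nonempty → X + -B ≠ univ → (X + -B).card ≤ X.card + κ →
      M.card ≤ X.card)
    (hFB : F + B ≠ univ) (hFκ : (F + B).card = F.card + κ) (hMF : (M ∩ F).Nonempty) :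
    M ⊆ F := by
  have hne : M ∩ F + B ≠ univ := fun h =>
    hMB (eq_univ_of_forall fun x => add_subset_add_right inter_subset_left (h ▸ mem_univ x))
  have h1 := hκ _ hMF hne
  have hsub : M ∩ F + B ⊆ (M + B) ∩ (F + B) := inter_add_subset
  have h2 := card_le_card hsub
  have h3 := card_union_add_card_inter (M + B) (F + B)
  have h4 := card_union_add_card_inter M F
  rw [← union_add] at h3
  -- the dual fragment of `F`
  have hFne : F.Nonempty := hMF.mono inter_subset_right
  have hstar : (F + B)ᶜ + -B ⊆ Fᶜ := by
    intro x hx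
    obtain ⟨y, hy, z, hz, rfl⟩ := mem_add.1 hx
    rw [mem_compl] at hy ⊢
    intro h
    exact hy (mem_add.2 ⟨_, h, -z, mem_neg'.1 hz, by abel⟩)
  have h5 : M.card ≤ ((F + B)ᶜ).card := by
    refine hmin' _ ?_ ?_ ?_
    · rwa [nonempty_iff_ne_empty, Ne, compl_eq_empty_iff]
    · intro h
      obtain ⟨x, hx⟩ := hFne
      exact mem_compl.1 (hstar (h ▸ mem_univ x)) hx
    · have h6 := card_le_card hstar
      have h7 := card_add_card_compl (F + B)
      have h8 := card_add_card_compl F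
      omega
  have h6 := card_add_card_compl (F + B)
  have h7 : 0 < (M ∩ F).card := hMF.card_pos
  have hun : M ∪ F + B ≠ univ := by
    intro h
    rw [h, card_univ] at h3
    omega
  have h8 := hκ _ (hFne.mono subset_union_right) hun
  have h9 := hmin _ hMF hne (by omega)
  exact inter_eq_left.1 (eq_of_subset_of_card_le inter_subset_left h9)

/-- The isoperimetric connectivity is attained at a subgroup. -/
lemma exists_addSubgroup_of_atom {B M : Finset G} {κ : ℕ} (hM : M.Nonempty)
    (hκ : ∀ X : Finset G, X.Nonempty → X + B ≠ univ → X.card + κ ≤ (X + B).card)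
    (hMB : M + B ≠ univ) (hMκ : (M + B).card = M.card + κ)
    (hmin : ∀ X : Finset G, X.Nonempty → X + B ≠ univ → (X + B).card = X.card + κ →
      M.card ≤ X.card)
    (hmin' : ∀ X : Finset G, X.Nonempty → X + -B ≠ univ → (X + -B).card ≤ X.card + κ →
      M.card ≤ X.card) :
    ∃ (H : AddSubgroup G) (T : Finset G), (T : Set G) = H ∧ T + B ≠ univ ∧
      (T + B).card = T.card + κ := by
  have hcard : ∀ (X : Finset G) (g : G), ((g +ᵥ X) + B).card = (X + B).card := fun X g => by
    rw [vadd_add_assoc, card_vadd_finset]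
  have huniv : ∀ (X : Finset G) (g : G), X + B ≠ univ → (g +ᵥ X) + B ≠ univ := fun X g h h' => by
    rw [Ne, ← card_eq_iff_eq_univ, ← hcard X g, card_eq_iff_eq_univ] at h
    exact h h'
  obtain ⟨x₀, hx₀⟩ := hM
  set T := -x₀ +ᵥ M with hT
  have h0 : (0 : G) ∈ T := by
    rw [hT, mem_vadd_finset]
    exact ⟨x₀, hx₀, by simp⟩
  have hTB : T + B ≠ univ := huniv _ _ hMB
  have hTM : T.card = M.card := card_vadd_finset _ _
  have hTκ : (T + B).card = T.card + κ := by rw [hcard, hTM, hMκ]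
  have hsub : ∀ x ∈ T, T ⊆ x +ᵥ T := fun x hx => by
    refine atom_subset_fragment hκ hTB hTκ (by rwa [hTM]) (by rwa [hTM]) (huniv _ _ hTB)
      (by rw [hcard, card_vadd_finset, hTκ]) ⟨x, mem_inter.2 ⟨hx, ?_⟩⟩
    rw [mem_vadd_finset]
    exact ⟨0, h0, by simp⟩
  refine ⟨AddSubgroup.ofSub (T : Set G) ⟨0, h0⟩ ?_, T, rfl, hTB, hTκ⟩
  intro y hy x hx
  obtain ⟨z, hz, rfl⟩ := mem_vadd_finset.1 (hsub x hx hy)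
  simpa using hz

/-- **Mann's theorem**, in isoperimetric form: the minimum of `(X - B).card - X.card` over the
sets `X` with `X - B ≠ univ` is attained at a subgroup. -/
lemma exists_addSubgroup_card_add_le {B : Finset G} (hB : B.Nonempty) (hBu : B ≠ univ) :
    ∃ (H : AddSubgroup G) (T : Finset G), (T : Set G) = H ∧ T + B ≠ univ ∧
      ∀ X : Finset G, X.Nonempty → X - B ≠ univ →
        X.card + (T + B).card ≤ (X - B).card + T.card := by
  classical
  set P : Finset (Finset G × Finset G) :=
    (univ ×ˢ {B, -B}).filter fun p => p.1.Nonempty ∧ p.1 + p.2 ≠ univ with hP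
  have hmem : ∀ X C : Finset G, (X, C) ∈ P ↔ (C = B ∨ C = -B) ∧ X.Nonempty ∧ X + C ≠ univ := by
    intro X C
    simp [hP]
  have hPne : P.Nonempty := ⟨({0}, B), by
    rw [hmem, singleton_zero, zero_add]
    exact ⟨Or.inl rfl, zero_nonempty, hBu⟩⟩
  obtain ⟨p, hp, hpmin⟩ := exists_min_image P (fun p => (p.1 + p.2).card - p.1.card) hPne
  set κ := (p.1 + p.2).card - p.1.card with hκ
  obtain ⟨⟨M, C⟩, hMC, hMmin⟩ := exists_min_image
    (P.filter fun p => (p.1 + p.2).card - p.1.card = κ) (fun p => p.1.card)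
    ⟨p, mem_filter.2 ⟨hp, rfl⟩⟩
  rw [mem_filter, hmem] at hMC
  obtain ⟨⟨hC, hM, hMCu⟩, hMκ⟩ := hMC
  have hle : ∀ X C : Finset G, (C = B ∨ C = -B) → X.card ≤ (X + C).card := by
    rintro X C (rfl | rfl)
    · exact card_le_card_add_right hB
    · exact card_le_card_add_right hB.neg
  have hκle : ∀ X C : Finset G, (C = B ∨ C = -B) → X.Nonempty → X + C ≠ univ →
      X.card + κ ≤ (X + C).card := by
    intro X C hC hX hXC
    have h1 := hpmin (X, C) ((hmem X C).2 ⟨hC, hX, hXC⟩)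
    have h2 := hle X C hC
    simp only at h1
    omega
  have hmin : ∀ X C : Finset G, (C = B ∨ C = -B) → X.Nonempty → X + C ≠ univ →
      (X + C).card ≤ X.card + κ → M.card ≤ X.card := by
    intro X C hC hX hXC h
    have h1 := hκle X C hC hX hXC
    exact hMmin (X, C) (mem_filter.2 ⟨(hmem X C).2 ⟨hC, hX, hXC⟩, by simp only; omega⟩)
  have hC' : -C = B ∨ -C = -B := by
    rcases hC with rfl | rfl
    · exact Or.inr rfl
    · exact Or.inl (neg_neg B)
  have hMle := hle M C hC
  simp only at hMκ
  obtain ⟨H, T, hTH, hTC, hTκ⟩ := exists_addSubgroup_of_atom (B := C) (κ := κ) hM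
    (fun X => hκle X C hC) hMCu (by omega) (fun X hX hXC h => hmin X C hC hX hXC h.le)
    (fun X => hmin X (-C) hC')
  have hTneg : -T = T := by
    ext x
    rw [mem_neg', ← mem_coe, ← mem_coe, hTH]
    simp
  have hcard : (T + B).card = (T + C).card := by
    rcases hC with rfl | rfl
    · rfl
    · rw [← card_neg (T + B), neg_add, hTneg]
  refine ⟨H, T, hTH, ?_, ?_⟩
  · rwa [Ne, ← card_eq_iff_eq_univ, hcard, card_eq_iff_eq_univ]
  · intro X hX hXB
    rw [sub_eq_add_neg] at hXB ⊢
    have := hκle X (-B) (Or.inr rfl) hX hXB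
    omega

end Isoperimetric

section Periodic

variable {G : Type*} [AddCommGroup G] [DecidableEq G]

/-- Two elements of a coset of `T` count more than `T.card` elements of `B` in their cosets, so
every element of the corresponding difference coset is a difference of elements of `B`. -/
lemma mem_sub_of_card_lt {B T : Finset G} {H : AddSubgroup G} (hT : (T : Set G) = H) {a b g : G}
    [DecidablePred (· ∈ H)]
    (hg : g - (a - b) ∈ H)
    (h : T.card < (B.filter (· - a ∈ H)).card + (B.filter (· - b ∈ H)).card) :
    g ∈ B - B := by
  have hTH : ∀ x, x ∈ T ↔ x ∈ H := fun x => by rw [← mem_coe, hT, SetLike.mem_coe]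
  have hnd : ¬ Disjoint (B.filter (· - a ∈ H)) ((B.filter (· - b ∈ H)).image (g + ·)) := by
    intro hd
    have hsub : B.filter (· - a ∈ H) ∪ (B.filter (· - b ∈ H)).image (g + ·) ⊆
        T.image (· + a) := by
      intro x hx
      refine mem_image.2 ⟨x - a, (hTH _).2 ?_, by abel⟩
      rcases mem_union.1 hx with hx | hx
      · exact (mem_filter.1 hx).2
      · obtain ⟨y, hy, rfl⟩ := mem_image.1 hx
        have := H.add_mem hg (mem_filter.1 hy).2
        convert this using 1
        abel
    have h1 := card_le_card hsub
    rw [card_union_of_disjoint hd, card_image_of_injective _ (add_right_injective g),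
      card_image_of_injective _ (add_left_injective a)] at h1
    omega
  obtain ⟨x, hx, hx'⟩ := not_disjoint_iff.1 hnd
  obtain ⟨y, hy, rfl⟩ := mem_image.1 hx'
  exact mem_sub.2 ⟨_, (mem_filter.1 hx).1, y, (mem_filter.1 hy).1, by abel⟩

/-- Counting the elements of `T + B` outside `B` in two cosets of the subgroup `T`. -/
lemma two_mul_card_add_card_le {B T : Finset G} {H : AddSubgroup G} (hT : (T : Set G) = H)
    {a b : G} [DecidablePred (· ∈ H)] (ha : a ∈ B) (hb : b ∈ B) (hab : a - b ∉ H) :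
    2 * T.card + B.card ≤
      (T + B).card + ((B.filter (· - a ∈ H)).card + (B.filter (· - b ∈ H)).card) := by
  have hTH : ∀ x, x ∈ T ↔ x ∈ H := fun x => by rw [← mem_coe, hT, SetLike.mem_coe]
  have hsplit : B ⊆ B.filter (fun x => x - a ∉ H ∧ x - b ∉ H) ∪
      (B.filter (· - a ∈ H) ∪ B.filter (· - b ∈ H)) := by
    intro x hx
    simp only [mem_union, mem_filter, hx, true_and]
    tauto
  have h1 := (card_le_card hsplit).trans (card_union_le _ _)
  have h2 := card_union_le (B.filter (· - a ∈ H)) (B.filter (· - b ∈ H))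
  have hd1 : Disjoint (T.image (· + a)) (T.image (· + b)) := by
    rw [disjoint_left]
    intro x hx hx'
    obtain ⟨y, hy, rfl⟩ := mem_image.1 hx
    obtain ⟨z, hz, h⟩ := mem_image.1 hx'
    apply hab
    have := H.sub_mem ((hTH z).1 hz) ((hTH y).1 hy)
    rwa [show a - b = z - y by rw [sub_eq_sub_iff_add_eq_add, h, add_comm]]
  have hd2 : Disjoint (B.filter (fun x => x - a ∉ H ∧ x - b ∉ H))
      (T.image (· + a) ∪ T.image (· + b)) := by
    rw [disjoint_left]
    intro x hx hx'
    have hx := (mem_filter.1 hx).2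
    rcases mem_union.1 hx' with h | h <;> obtain ⟨y, hy, rfl⟩ := mem_image.1 h
    · exact hx.1 (by simpa using (hTH y).1 hy)
    · exact hx.2 (by simpa using (hTH y).1 hy)
  have hsub : B.filter (fun x => x - a ∉ H ∧ x - b ∉ H) ∪
      (T.image (· + a) ∪ T.image (· + b)) ⊆ T + B := by
    intro x hx
    rcases mem_union.1 hx with h | h
    · exact mem_add.2 ⟨0, (hTH 0).2 H.zero_mem, x, (mem_filter.1 h).1, zero_add x⟩
    · rcases mem_union.1 h with h | h <;> obtain ⟨y, hy, rfl⟩ := mem_image.1 h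
      · exact add_mem_add hy ha
      · exact add_mem_add hy hb
  have h3 := card_le_card hsub
  rw [card_union_of_disjoint hd2, card_union_of_disjoint hd1,
    card_image_of_injective _ (add_left_injective a),
    card_image_of_injective _ (add_left_injective b)] at h3
  omega

/-- If `B - B` is not everything and `B` lies in no proper subgroup, then there is a subgroup `T`
such that `B` nearly fills the cosets of `T` that it meets and `B - B` is a union of at least
`2 * u - 1` cosets of `T`, where `u` is the number of cosets met by `B`. -/
lemma exists_addSubgroup_sub_periodic [Fintype G] {B : Finset G} (h0 : 0 ∈ B)
    (hgen : ∀ H : AddSubgroup G, (∀ x ∈ B, x ∈ H) → H = ⊤) (hBB : B - B ≠ univ) :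
    ∃ (H : AddSubgroup G) (T : Finset G), (T : Set G) = H ∧
      (T + B).card + 1 ≤ B.card + T.card ∧
      2 * (T + B).card ≤ (B - B).card + T.card ∧ T.card < (T + B).card := by
  classical
  have hBsub : B ⊆ B - B := fun x hx => mem_sub.2 ⟨x, hx, 0, h0, sub_zero x⟩
  have hBu : B ≠ univ := fun h => hBB (eq_univ_of_forall fun x => hBsub (h ▸ mem_univ x))
  obtain ⟨H, T, hT, hTB, hiso⟩ := exists_addSubgroup_card_add_le ⟨0, h0⟩ hBu
  have hTH : ∀ x, x ∈ T ↔ x ∈ H := fun x => by rw [← mem_coe, hT, SetLike.mem_coe]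
  have hsmall : (T + B).card + 1 ≤ B.card + T.card := by
    have hneg : ({0} : Finset G) - B = -B := by rw [singleton_zero, zero_sub]
    have h := hiso {0} (singleton_nonempty 0) (by
      rwa [hneg, Ne, ← card_eq_iff_eq_univ, card_neg, card_eq_iff_eq_univ])
    rw [hneg, card_neg, card_singleton] at h
    omega
  obtain ⟨a, ha, haH⟩ : ∃ a ∈ B, a ∉ H := by
    by_contra! h
    have htop := hgen H h
    refine hTB (eq_univ_of_forall fun x => mem_add.2 ⟨x, ?_, 0, h0, add_zero x⟩)
    rw [hTH, htop]
    exact AddSubgroup.mem_top x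
  have hpair : ∀ c ∈ B, ∀ d ∈ B, c - d ∉ H →
      T.card < (B.filter (· - c ∈ H)).card + (B.filter (· - d ∈ H)).card := by
    intro c hc d hd hcd
    have := two_mul_card_add_card_le hT hc hd hcd
    omega
  have hper : (T + B) - B ⊆ B - B := by
    intro g hg
    obtain ⟨x, hx, b, hb, rfl⟩ := mem_sub.1 hg
    obtain ⟨t, ht, c, hc, rfl⟩ := mem_add.1 hx
    have htH := (hTH t).1 ht
    by_cases hcb : c - b ∈ H
    · have hmem : ∀ d : G, t + c - b - (d - d) ∈ H := fun d => by
        rw [sub_self, sub_zero, add_sub_assoc]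
        exact H.add_mem htH hcb
      have h := hpair a ha 0 h0 (by rwa [sub_zero])
      rcases le_total (B.filter (· - a ∈ H)).card (B.filter (· - 0 ∈ H)).card with h' | h'
      · exact mem_sub_of_card_lt hT (hmem 0) (by omega)
      · exact mem_sub_of_card_lt hT (hmem a) (by omega)
    · exact mem_sub_of_card_lt hT (by rwa [show t + c - b - (c - b) = t by abel])
        (hpair c hc b hb hcb)
  refine ⟨H, T, hT, hsmall, ?_, ?_⟩
  · have hne : T + B - B ≠ univ := fun h => hBB (eq_univ_of_forall fun x => hper (h ▸ mem_univ x))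
    have h := hiso (T + B) ⟨a, mem_add.2 ⟨0, (hTH 0).2 H.zero_mem, a, ha, zero_add a⟩⟩ hne
    have := card_le_card hper
    omega
  · refine card_lt_card ⟨fun x hx => mem_add.2 ⟨x, hx, 0, h0, add_zero x⟩, fun h => haH ?_⟩
    exact (hTH a).1 (h (mem_add.2 ⟨0, (hTH 0).2 H.zero_mem, a, ha, zero_add a⟩))

end Periodic

/-- **Freiman's theorem** on difference sets: a set of `k` integers spanning an interval of length
`ℓ ≥ 2 * k - 3` and contained in no proper arithmetic progression has at least `3 * k - 3`
differences. -/
lemma three_mul_card_le_card_sub {A : Finset ℤ} {ℓ : ℕ} (hℓ0 : 0 < ℓ) (h0 : 0 ∈ A)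
    (hℓ : (ℓ : ℤ) ∈ A) (hA : A ⊆ Icc 0 (ℓ : ℤ)) (hgcd : ∀ d : ℤ, (∀ a ∈ A, d ∣ a) → d ∣ 1)
    (hlen : 2 * A.card ≤ ℓ + 3) : 3 * A.card ≤ (A - A).card + 3 := by
  classical
  have : NeZero ℓ := ⟨hℓ0.ne'⟩
  have hI : ∀ x ∈ A, 0 ≤ x ∧ x ≤ ℓ := fun x hx => mem_Icc.1 (hA hx)
  set φ : ℤ →+ ZMod ℓ := Int.castAddHom (ZMod ℓ) with hφ
  have hφeq : ∀ x y : ℤ, φ x = φ y ↔ (ℓ : ℤ) ∣ y - x := fun x y =>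
    ZMod.intCast_eq_intCast_iff_dvd_sub x y ℓ
  have hφℓ : φ ℓ = 0 := by
    rw [← map_zero φ, hφeq, zero_sub, dvd_neg]
  set A' := A.erase (ℓ : ℤ) with hA'
  have hI' : ∀ x ∈ A', x ∈ A ∧ 0 ≤ x ∧ x < ℓ := fun x hx => by
    obtain ⟨h1, h2⟩ := mem_erase.1 hx
    have := hI x h2
    exact ⟨h2, this.1, lt_of_le_of_ne this.2 h1⟩
  have hA'card : A'.card + 1 = A.card := card_erase_add_one hℓ
  have h0' : (0 : ℤ) ∈ A' := mem_erase.2 ⟨by exact_mod_cast hℓ0.ne, h0⟩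
  set B := A'.image φ with hB
  have hBcard : B.card = A'.card := by
    refine card_image_of_injOn fun x hx y hy hxy => ?_
    have hx := hI' x hx
    have hy := hI' y hy
    have := Int.eq_zero_of_abs_lt_dvd ((hφeq x y).1 hxy)
      (by rw [abs_lt]; constructor <;> linarith)
    linarith
  have hAB : ∀ x ∈ A, φ x ∈ B := fun x hx => by
    by_cases h : x = ℓ
    · rw [h, hφℓ, ← map_zero φ]
      exact mem_image_of_mem φ h0'
    · exact mem_image_of_mem φ (mem_erase.2 ⟨h, hx⟩)
  have h0B : (0 : ZMod ℓ) ∈ B := map_zero φ ▸ hAB 0 h0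
  have hgen : ∀ H : AddSubgroup (ZMod ℓ), (∀ x ∈ B, x ∈ H) → H = ⊤ := by
    intro H hH
    obtain ⟨d, hd⟩ := Int.subgroup_cyclic (H.comap φ)
    rw [← AddSubgroup.zmultiples_eq_closure] at hd
    have hdA : ∀ a ∈ A, d ∣ a := fun a ha => by
      rw [← Int.mem_zmultiples_iff, ← hd]
      exact hH _ (hAB a ha)
    rw [AddSubgroup.eq_top_iff']
    intro x
    obtain ⟨z, rfl⟩ := ZMod.intCast_surjective x
    change z ∈ H.comap φ
    rw [hd, Int.mem_zmultiples_iff]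
    exact (hgcd d hdA).trans (one_dvd z)
  -- residues of differences with a second representative in `E`
  set E := insert (ℓ : ℤ) (A'.image (· - (ℓ : ℤ))) with hE
  have hEcard : E.card = A.card := by
    rw [hE, card_insert_of_notMem, card_image_of_injective _ sub_left_injective, hA'card]
    intro h
    obtain ⟨y, hy, h⟩ := mem_image.1 h
    have := hI' y hy
    omega
  have hED : E ⊆ A - A := by
    intro x hx
    rcases mem_insert.1 hx with rfl | hx
    · exact mem_sub.2 ⟨_, hℓ, 0, h0, sub_zero _⟩
    · obtain ⟨y, hy, rfl⟩ := mem_image.1 hx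
      exact sub_mem_sub (hI' y hy).1 hℓ
  have hA'E : ∀ x ∈ A', x ∈ (A - A) \ E := by
    intro x hx
    obtain ⟨hxA, hx0, hxℓ⟩ := hI' x hx
    refine mem_sdiff.2 ⟨mem_sub.2 ⟨x, hxA, 0, h0, sub_zero x⟩, fun h => ?_⟩
    rcases mem_insert.1 h with h | h
    · exact hxℓ.ne h
    · obtain ⟨y, hy, h⟩ := mem_image.1 h
      have := hI' y hy
      omega
  have hEA' : ∀ x ∈ E, ∃ y ∈ A', φ x = φ y := by
    intro x hx
    rcases mem_insert.1 hx with rfl | hx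
    · exact ⟨0, h0', by rw [hφℓ, map_zero]⟩
    · obtain ⟨y, hy, rfl⟩ := mem_image.1 hx
      exact ⟨y, hy, by rw [map_sub, hφℓ, sub_zero]⟩
  have hrep : ∀ r ∈ B - B, ∃ x ∈ (A - A) \ E, φ x = r := by
    intro r hr
    obtain ⟨_, haB, _, hbB, rfl⟩ := mem_sub.1 hr
    obtain ⟨a, ha, rfl⟩ := mem_image.1 haB
    obtain ⟨b, hb, rfl⟩ := mem_image.1 hbB
    rw [← map_sub]
    by_cases h : a - b ∈ E
    · obtain ⟨y, hy, hxy⟩ := hEA' _ h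
      exact ⟨y, hA'E y hy, hxy.symm⟩
    · exact ⟨a - b, mem_sdiff.2 ⟨sub_mem_sub (hI' a ha).1 (hI' b hb).1, h⟩, rfl⟩
  have hDE : ((A - A) \ E).card + A.card = (A - A).card := by
    rw [← hEcard, card_sdiff_add_card_eq_card hED]
  by_cases hBB : B - B = univ
  · have h1 : (B - B).card ≤ ((A - A) \ E).card :=
      (card_le_card fun r hr => by simpa using hrep r hr).trans (card_image_le (f := φ))
    rw [hBB, card_univ, ZMod.card] at h1
    omega
  obtain ⟨H, T, hT, hsmall, hbig, hlt⟩ := exists_addSubgroup_sub_periodic h0B hgen hBB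
  have hTH : ∀ x, x ∈ T ↔ x ∈ H := fun x => by rw [← mem_coe, hT, SetLike.mem_coe]
  obtain ⟨r, hr, hrT⟩ : ∃ r ∈ B - B, r ∉ T + B :=
    exists_mem_notMem_of_card_lt_card (by omega)
  obtain ⟨a, ha, b, hb, rfl⟩ := mem_sub.1 hr
  have hab : a - b ∉ H := fun h =>
    hrT (mem_add.2 ⟨a - b, (hTH _).2 h, 0, h0B, add_zero _⟩)
  have hcount := two_mul_card_add_card_le hT ha hb hab
  have hfib : ∀ c : ZMod ℓ, (B.filter (· - c ∈ H)).card ≤ (A.filter (φ · - c ∈ H)).card := by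
    intro c
    refine (card_le_card fun x hx => ?_).trans (card_image_le (f := φ))
    obtain ⟨hxB, hx⟩ := mem_filter.1 hx
    obtain ⟨y, hy, rfl⟩ := mem_image.1 hxB
    exact mem_image_of_mem φ (mem_filter.2 ⟨(hI' y hy).1, hx⟩)
  have hne : ∀ c ∈ B, (A.filter (φ · - c ∈ H)).Nonempty := by
    intro c hc
    obtain ⟨y, hy, rfl⟩ := mem_image.1 hc
    exact ⟨y, mem_filter.2 ⟨(hI' y hy).1, by rw [sub_self]; exact H.zero_mem⟩⟩
  set K := A.filter (φ · - a ∈ H) - A.filter (φ · - b ∈ H) with hK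
  have hKcard : (A.filter (φ · - a ∈ H)).card + (A.filter (φ · - b ∈ H)).card ≤ K.card + 1 := by
    have h := cauchy_davenport_add_of_linearOrder_isCancelAdd (hne a ha) (hne b hb).neg
    rw [← sub_eq_add_neg, card_neg, ← hK] at h
    omega
  have hKr : ∀ x ∈ K, φ x - (a - b) ∈ H := by
    intro x hx
    obtain ⟨y, hy, z, hz, rfl⟩ := mem_sub.1 hx
    have := H.sub_mem (mem_filter.1 hy).2 (mem_filter.1 hz).2
    rw [map_sub]
    convert this using 1
    abel
  have hKE : K ⊆ (A - A) \ E := by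
    intro x hx
    refine mem_sdiff.2 ⟨sub_subset_sub (filter_subset _ _) (filter_subset _ _) hx, fun hxE => ?_⟩
    obtain ⟨y, hy, hxy⟩ := hEA' x hxE
    have h := hKr x hx
    rw [hxy] at h
    refine hrT (mem_add.2 ⟨-(φ y - (a - b)), (hTH _).2 (H.neg_mem h), φ y,
      mem_image_of_mem φ hy, by abel⟩)
  have hrest : (B - B).card ≤ (((A - A) \ E) \ K).card + T.card := by
    have hsub : B - B ⊆ (((A - A) \ E) \ K).image φ ∪ T.image (· + (a - b)) := by
      intro s hs
      obtain ⟨x, hx, rfl⟩ := hrep s hs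
      by_cases hxK : x ∈ K
      · refine mem_union_right _ (mem_image.2 ⟨φ x - (a - b), (hTH _).2 (hKr x hxK), by abel⟩)
      · exact mem_union_left _ (mem_image_of_mem φ (mem_sdiff.2 ⟨hx, hxK⟩))
    exact (card_le_card hsub).trans ((card_union_le _ _).trans
      (add_le_add card_image_le card_image_le))
  have hKsplit := card_sdiff_add_card_eq_card hKE
  have hBT : B.card ≤ (T + B).card := card_le_card_add_left ⟨0, (hTH 0).2 H.zero_mem⟩
  have h1 := hfib a
  have h2 := hfib b
  omega

/-- In a sum-free set of integers containing `m > 0`, every interval of `2 * m` integers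
contains at most `m` elements. -/
lemma card_filter_Ioc_le {S : Finset ℤ} (hS : ∀ x ∈ S, ∀ y ∈ S, x + y ∉ S) {m : ℤ}
    (hm : m ∈ S) (hm0 : 0 < m) (t : ℤ) :
    ((S.filter (· ∈ Ioc t (t + 2 * m))).card : ℤ) ≤ m := by
  have hsub : S.filter (· ∈ Ioc t (t + 2 * m)) ⊆
      S.filter (· ∈ Ioc t (t + m)) ∪ S.filter (· ∈ Ioc (t + m) (t + 2 * m)) := by
    intro x
    simp only [mem_filter, mem_union, mem_Ioc]
    rintro ⟨h, h1, h2⟩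
    rcases le_or_gt x (t + m) with h3 | h3
    · exact Or.inl ⟨h, h1, h3⟩
    · exact Or.inr ⟨h, h3, h2⟩
  have h1 := (card_le_card hsub).trans (card_union_le _ _)
  have hdisj : Disjoint ((S.filter (· ∈ Ioc t (t + m))).image (· + m))
      (S.filter (· ∈ Ioc (t + m) (t + 2 * m))) := by
    rw [disjoint_left]
    intro x hx hx'
    obtain ⟨y, hy, rfl⟩ := mem_image.1 hx
    exact hS y (mem_filter.1 hy).1 m hm (mem_filter.1 hx').1
  have h2 : ((S.filter (· ∈ Ioc t (t + m))).image (· + m) ∪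
      S.filter (· ∈ Ioc (t + m) (t + 2 * m))) ⊆ Ioc (t + m) (t + 2 * m) := by
    intro x hx
    rcases mem_union.1 hx with hx | hx
    · obtain ⟨y, hy, rfl⟩ := mem_image.1 hx
      have := mem_Ioc.1 (mem_filter.1 hy).2
      rw [mem_Ioc]
      constructor <;> linarith
    · exact (mem_filter.1 hx).2
  have h3 := card_le_card h2
  rw [card_union_of_disjoint hdisj, card_image_of_injective _ (add_left_injective m),
    Int.card_Ioc] at h3
  omega

/-- If `S` is a sum-free set contained in an interval of fewer than `2 * S.card` integers,
then `S + S` avoids a whole range of integers. -/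
lemma add_ne_of_lt_two_mul_card {S : Finset ℤ} (hS : ∀ x ∈ S, ∀ y ∈ S, x + y ∉ S) {m M : ℤ}
    (hm0 : 0 < m) (hSI : S ⊆ Icc m M) {N : ℤ} (hN : M - m < N) (hN2 : N < 2 * S.card)
    {a b : ℤ} (ha : a ∈ S) (hb : b ∈ S) : a + b ≠ N := by
  intro hab
  have hI : ∀ x ∈ S, m ≤ x ∧ x ≤ M := fun x hx => mem_Icc.1 (hSI hx)
  have ha' := hI a ha
  have hb' := hI b hb
  have hNpos : 0 < N := by linarith
  have hinj : Set.InjOn (· % N) (S : Set ℤ) := by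
    intro x hx y hy hxy
    have hx' := hI x hx
    have hy' := hI y hy
    have hd : N ∣ x - y := Int.ModEq.dvd (Int.ModEq.symm hxy)
    have := Int.eq_zero_of_abs_lt_dvd hd (by rw [abs_lt]; constructor <;> linarith)
    linarith
  have hinj' : Set.InjOn (fun x => (x + a) % N) (S : Set ℤ) := by
    intro x hx y hy hxy
    have h1 : x + a ≡ y + a [ZMOD N] := hxy
    exact hinj hx hy (Int.ModEq.add_right_cancel' a h1)
  have hdisj : Disjoint (S.image (· % N)) (S.image fun x => (x + a) % N) := by
    rw [disjoint_left]
    intro z hz hz'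
    obtain ⟨x, hx, rfl⟩ := mem_image.1 hz
    obtain ⟨y, hy, hxy⟩ := mem_image.1 hz'
    have hx' := hI x hx
    have hy' := hI y hy
    have hd : N ∣ x - (y + a) := Int.ModEq.dvd (show y + a ≡ x [ZMOD N] from hxy)
    obtain ⟨c, hc⟩ := hd
    have hc1 : c < 1 := by nlinarith
    have hc2 : -2 < c := by nlinarith
    obtain rfl | rfl : c = 0 ∨ c = -1 := by omega
    · exact hS y hy a ha (by convert hx using 1; linarith)
    · exact hS x hx b hb (by convert hy using 1; linarith)
  have hsub : S.image (· % N) ∪ (S.image fun x => (x + a) % N) ⊆ Ico 0 N := by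
    intro z hz
    rw [mem_Ico]
    rcases mem_union.1 hz with hz | hz <;> obtain ⟨x, _, rfl⟩ := mem_image.1 hz <;>
      exact ⟨Int.emod_nonneg _ hNpos.ne', Int.emod_lt_of_pos _ hNpos⟩
  have h := card_le_card hsub
  rw [card_union_of_disjoint hdisj, card_image_of_injOn hinj, card_image_of_injOn hinj',
    Int.card_Ico] at h
  omega

/-- A sum-free set of positive integers that is dense in its convex hull has at most as many
elements as its minimum. -/
lemma card_le_of_sub_le {S : Finset ℤ} (hS : ∀ x ∈ S, ∀ y ∈ S, x + y ∉ S) {m M : ℤ}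
    (hm : m ∈ S) (hm0 : 0 < m) (hSI : S ⊆ Icc m M) (hd : M - m ≤ 2 * S.card - 3) :
    (S.card : ℤ) ≤ m := by
  by_contra! hlt
  have hI : ∀ x ∈ S, m ≤ x ∧ x ≤ M := fun x hx => mem_Icc.1 (hSI hx)
  set P := S.filter (· ≤ M - 2 * m) with hP
  have hPcard : (S.card : ℤ) - m ≤ P.card := by
    have h1 := card_filter_Ioc_le hS hm hm0 (M - 2 * m)
    have h2 := card_filter_add_card_filter_not (s := S) (· ≤ M - 2 * m)
    have h3 : S.filter (fun x => ¬ x ≤ M - 2 * m) ⊆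
        S.filter (· ∈ Ioc (M - 2 * m) (M - 2 * m + 2 * m)) := by
      intro x hx
      rw [mem_filter] at hx ⊢
      rw [mem_Ioc]
      exact ⟨hx.1, not_le.1 hx.2, by linarith [(hI x hx.1).2]⟩
    have h4 := card_le_card h3
    rw [← hP] at h2
    omega
  have hPne : P.Nonempty := card_pos.1 (by omega)
  set q := P.max' hPne with hq
  have hPS : ∀ x ∈ P, x ∈ S ∧ m ≤ x ∧ x ≤ M - 2 * m := fun x hx =>
    ⟨(mem_filter.1 hx).1, (hI x (mem_filter.1 hx).1).1, (mem_filter.1 hx).2⟩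
  have hqP : q ∈ P := max'_mem _ _
  set k : ℤ := (↑S.card : ℤ) with hk
  have hdisj : Disjoint P (insert (2 * k - 2 - q) (P.image (2 * k - 1 - ·))) := by
    rw [disjoint_left]
    intro x hx hx'
    rcases mem_insert.1 hx' with h | h
    · exact add_ne_of_lt_two_mul_card hS hm0 hSI (N := 2 * k - 2) (by omega) (by omega)
        (hPS x hx).1 (hPS q hqP).1 (by omega)
    · obtain ⟨y, hy, h⟩ := mem_image.1 h
      exact add_ne_of_lt_two_mul_card hS hm0 hSI (N := 2 * k - 1) (by omega) (by omega)
        (hPS x hx).1 (hPS y hy).1 (by omega)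
  have hnot : 2 * k - 2 - q ∉ P.image (2 * k - 1 - ·) := by
    intro h
    obtain ⟨y, hy, h⟩ := mem_image.1 h
    have := le_max' P y hy
    omega
  have hsub : P ∪ insert (2 * k - 2 - q) (P.image (2 * k - 1 - ·)) ⊆ Icc m (2 * k - 1 - m) := by
    intro x hx
    rw [mem_Icc]
    rcases mem_union.1 hx with h | h
    · have := hPS x h
      omega
    · rcases mem_insert.1 h with h | h
      · have := hPS q hqP
        omega
      · obtain ⟨y, hy, h⟩ := mem_image.1 h
        have := hPS y hy
        omega
  have h := card_le_card hsub
  rw [card_union_of_disjoint hdisj, card_insert_of_notMem hnot,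
    card_image_of_injective _ sub_right_injective, Int.card_Icc] at h
  omega

/-- A sum-free set of positive integers with minimum `m` and maximum `M` that is not all
odd and has more than `(2 * M + 5) / 5` elements is dense in `[m, M]`. -/
lemma sub_le_of_two_fifths_lt {S : Finset ℤ} (hS : ∀ x ∈ S, ∀ y ∈ S, x + y ∉ S) {m M : ℤ}
    (hm : m ∈ S) (hM : M ∈ S) (hm0 : 0 < m) (hSI : S ⊆ Icc m M) (hodd : ∃ a ∈ S, Even a)
    (hcard : 2 * M + 5 < 5 * S.card) : M - m ≤ 2 * S.card - 3 := by
  have hI : ∀ x ∈ S, m ≤ x ∧ x ≤ M := fun x hx => mem_Icc.1 (hSI hx)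
  have hmM := (hI m hm).2
  have hlt : m < M := by
    refine lt_of_le_of_ne hmM fun h => ?_
    have h1 := card_le_card hSI
    rw [h, Icc_self, card_singleton] at h1
    omega
  by_contra! hlen
  have hgcd : ∀ d : ℤ, 0 ≤ d → (∀ a ∈ S, d ∣ a - m) → d ∣ 1 := by
    intro d hd0 hd
    have hdpos : 0 < d := by
      refine lt_of_le_of_ne hd0 fun h => ?_
      have := hd M hM
      rw [← h, zero_dvd_iff] at this
      omega
    by_contra hd1
    have hd2 : d ≠ 1 := fun h => hd1 h.dvd
    rcases eq_or_ne d 2 with rfl | hd3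
    · -- all elements are even, and so are the differences `M - x`
      have heven : ∀ a ∈ S, 2 ∣ a := by
        obtain ⟨e, he, hee⟩ := hodd
        intro a ha
        have h1 := hd e he
        have h2 := hd a ha
        have h3 := hee.two_dvd
        omega
      have hdisj : Disjoint S ((S.erase M).image (M - ·)) := by
        rw [disjoint_left]
        intro x hx hx'
        obtain ⟨y, hy, rfl⟩ := mem_image.1 hx'
        exact hS _ hx y (mem_erase.1 hy).2 (by rwa [sub_add_cancel])
      have hsub : S ∪ (S.erase M).image (M - ·) ⊆ (Icc 1 (M / 2)).image (2 * ·) := by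
        intro x hx
        have : 2 ∣ x ∧ 0 < x ∧ x ≤ M := by
          rcases mem_union.1 hx with h | h
          · have := hI x h
            exact ⟨heven x h, by omega, by omega⟩
          · obtain ⟨y, hy, rfl⟩ := mem_image.1 h
            obtain ⟨hyM, hy⟩ := mem_erase.1 hy
            have := hI y hy
            exact ⟨dvd_sub (heven M hM) (heven y hy), by omega, by omega⟩
        refine mem_image.2 ⟨x / 2, mem_Icc.2 ?_, ?_⟩ <;> omega
      have h1 := (card_le_card hsub).trans card_image_le
      rw [card_union_of_disjoint hdisj, card_image_of_injective _ sub_right_injective,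
        card_erase_of_mem hM, Int.card_Icc] at h1
      omega
    · have hsub : S ⊆ (Icc 0 ((M - m) / d)).image (m + d * ·) := by
        intro x hx
        obtain ⟨c, hc⟩ := hd x hx
        have hx' := hI x hx
        refine mem_image.2 ⟨c, mem_Icc.2 ⟨?_, ?_⟩, by omega⟩
        · by_contra! h
          nlinarith
        · rw [Int.le_ediv_iff_mul_le hdpos]
          nlinarith
      have h1 := (card_le_card hsub).trans card_image_le
      have h2 : (M - m) / d * d ≤ M - m := Int.ediv_mul_le _ hdpos.ne'
      have h3 : 0 ≤ (M - m) / d := Int.ediv_nonneg (by omega) hd0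
      have h4 : 3 ≤ d := by omega
      have h5 : (M - m) / d * 3 ≤ M - m := by nlinarith
      rw [Int.card_Icc] at h1
      omega
  -- many differences
  set A := S.image (· - m) with hA
  have hAcard : A.card = S.card := card_image_of_injective _ sub_left_injective
  have hAA : A - A = S - S := by
    ext x
    simp only [hA, mem_sub, mem_image, exists_exists_and_eq_and, sub_sub_sub_cancel_right]
  obtain ⟨ℓ, hℓ⟩ := Int.eq_ofNat_of_zero_le (sub_nonneg.2 hmM)
  have hdiff : 3 * A.card ≤ (A - A).card + 3 := by
    refine three_mul_card_le_card_sub (ℓ := ℓ) (by omega) (mem_image.2 ⟨m, hm, sub_self m⟩)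
      (mem_image.2 ⟨M, hM, hℓ⟩) ?_ ?_ (by omega)
    · intro x hx
      obtain ⟨y, hy, rfl⟩ := mem_image.1 hx
      have := hI y hy
      rw [mem_Icc]
      omega
    · intro d hd
      rw [← abs_dvd]
      exact hgcd _ (abs_nonneg d) fun a ha => (abs_dvd _ _).2 (hd _ (mem_image_of_mem _ ha))
  rw [hAA, hAcard] at hdiff
  set P := (S - S).filter (0 < ·) with hP
  have hneg : S - S ⊆ insert 0 (P ∪ -P) := by
    intro x hx
    rw [mem_insert, mem_union, mem_neg', hP, mem_filter, mem_filter]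
    rcases lt_trichotomy x 0 with h | h | h
    · have hx' : -x ∈ S - S := by
        obtain ⟨y, hy, z, hz, rfl⟩ := mem_sub.1 hx
        rw [neg_sub]
        exact sub_mem_sub hz hy
      exact Or.inr (Or.inr ⟨hx', by omega⟩)
    · exact Or.inl h
    · exact Or.inr (Or.inl ⟨hx, h⟩)
  have h1 := card_le_card hneg
  have h2 := card_insert_le (0 : ℤ) (P ∪ -P)
  have h3 := card_union_le P (-P)
  rw [card_neg] at h3
  have hdisj : Disjoint S P := by
    rw [disjoint_left]
    intro x hx hxP
    obtain ⟨y, hy, z, hz, rfl⟩ := mem_sub.1 (mem_filter.1 hxP).1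
    exact hS _ hx z hz (by rwa [sub_add_cancel])
  have hsub : S ∪ P ⊆ Icc 1 M := by
    intro x hx
    rw [mem_Icc]
    rcases mem_union.1 hx with h | h
    · have := hI x h
      omega
    · obtain ⟨h, hx0⟩ := mem_filter.1 h
      obtain ⟨y, hy, z, hz, rfl⟩ := mem_sub.1 h
      have := hI y hy
      have := hI z hz
      omega
  have h4 := card_le_card hsub
  rw [card_union_of_disjoint hdisj, Int.card_Icc] at h4
  omega

end SumFreeStructure

theorem stmt4 (n : ℕ) (S : Finset ℕ) (hSn : S ⊆ Finset.Icc 1 n) (hsf : SumFree S) :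
    (S.card : ℝ) ≤ 2 * n / 5 + 1 ∨
    (∀ a ∈ S, Odd a) ∨
    (S = ∅ ∨ ∃ h : S.Nonempty, S.card ≤ S.min' h) := by
  rw [or_iff_not_imp_left, or_iff_not_imp_left, or_iff_not_imp_left]
  intro hlarge hodd hne
  replace hne : S.Nonempty := Finset.nonempty_iff_ne_empty.2 hne
  refine ⟨hne, ?_⟩
  push Not at hlarge hodd
  have hlarge' : 2 * n + 5 < 5 * S.card := by
    have : (2 * n + 5 : ℝ) < 5 * S.card := by linarith
    exact_mod_cast this
  set Z := S.map (Nat.castEmbedding (R := ℤ)) with hZ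
  have hZcard : Z.card = S.card := Finset.card_map _
  have hmem : ∀ x ∈ S, (x : ℤ) ∈ Z := fun x hx => Finset.mem_map_of_mem Nat.castEmbedding hx
  have hZsf : ∀ x ∈ Z, ∀ y ∈ Z, x + y ∉ Z := by
    intro x hx y hy hxy
    obtain ⟨a, ha, rfl⟩ := Finset.mem_map.1 hx
    obtain ⟨b, hb, rfl⟩ := Finset.mem_map.1 hy
    obtain ⟨c, hc, h⟩ := Finset.mem_map.1 hxy
    refine hsf a ha b hb ?_
    have h : c = a + b := Nat.cast_injective (R := ℤ) (by rw [Nat.cast_add]; exact h)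
    rwa [← h]
  have hm0 := (Finset.mem_Icc.1 (hSn (S.min'_mem hne))).1
  have hMn := (Finset.mem_Icc.1 (hSn (S.max'_mem hne))).2
  have hZI : Z ⊆ Finset.Icc (S.min' hne : ℤ) (S.max' hne : ℤ) := by
    intro x hx
    obtain ⟨a, ha, rfl⟩ := Finset.mem_map.1 hx
    have h1 := S.min'_le a ha
    have h2 := S.le_max' a ha
    exact Finset.mem_Icc.2 ⟨Int.ofNat_le.2 h1, Int.ofNat_le.2 h2⟩
  have heven : ∃ a ∈ Z, Even a := by
    obtain ⟨a, ha, hao⟩ := hodd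
    exact ⟨a, hmem a ha, (Int.even_coe_nat a).2 (by simpa using hao)⟩
  have hdense := sub_le_of_two_fifths_lt hZsf (hmem _ (S.min'_mem hne)) (hmem _ (S.max'_mem hne))
    (by omega) hZI heven (by omega)
  have := card_le_of_sub_le hZsf (hmem _ (S.min'_mem hne)) (by omega) hZI hdense
  omega
end

section
/- For every ε > 0 there exist δ > 0 and N such that for all n ≥ N the following holds: if A ⊆ [n] contains at most δn² Schur triples, then there exist sets B and C with A = B ∪ C, B sum-free, and |C| ≤ εn. -/
/-- The number of Schur triples in `A`: pairs `(x, y) ∈ A × A` with `x + y ∈ A`. -/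
def schurTriples (A : Finset ℕ) : ℕ :=
  ((A ×ˢ A).filter (fun p => p.1 + p.2 ∈ A)).card

open Finset Fintype Sum3 SimpleGraph SimpleGraph.TripartiteFromTriangles in
/-- The triangles of a tripartite-from-triangles graph are all explicit as soon as the index set
contains every triple whose three pairs of coordinates come from members of the index set. -/
theorem card_cliqueFinset_graph_le {α β γ : Type*} [Fintype α] [Fintype β] [Fintype γ]
    [DecidableEq α] [DecidableEq β] [DecidableEq γ] {t : Finset (α × β × γ)}
    (ht : ∀ a a' b b' c c', (a', b, c) ∈ t → (a, b', c) ∈ t → (a, b, c') ∈ t → (a, b, c) ∈ t) :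
    #((graph t).cliqueFinset 3) ≤ #t := by
  rw [← card_map toTriangle]
  refine card_le_card fun u hu ↦ ?_
  rw [mem_cliqueFinset_iff, is3Clique_iff] at hu
  obtain ⟨x, y, z, hxy, hxz, hyz, rfl⟩ := hu
  obtain ⟨a, b, c, habc, hab, hac, hbc⟩ := graph_triple hxy hxz hyz
  obtain ⟨c', hc'⟩ := Graph.in₀₁_iff.1 hab
  obtain ⟨b', hb'⟩ := Graph.in₀₂_iff.1 hac
  obtain ⟨a', ha'⟩ := Graph.in₁₂_iff.1 hbc
  exact mem_map.2 ⟨(a, b, c), ht _ _ _ _ _ _ ha' hb' hc', habc⟩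

open Finset in
theorem sum_card_fiber_le_of_injective {ι κ E : Type*} [Fintype ι] [Fintype κ] [DecidableEq E]
    {f : ι × κ → E} (hf : f.Injective) (s : Finset E) :
    ∑ i, #{k | f (i, k) ∈ s} ≤ #s := by
  rw [← card_sigma]
  refine card_le_card_of_injOn (fun p ↦ f (p.1, p.2)) (fun p hp ↦ by simpa using hp) ?_
  rintro ⟨i, k⟩ - ⟨i', k'⟩ - h
  obtain ⟨rfl, rfl⟩ := Prod.mk.inj (hf h)
  rfl

open Finset Fintype Sum3 SimpleGraph SimpleGraph.TripartiteFromTriangles in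
/-- **Removal lemma for Schur triples** in a finite abelian group. -/
theorem exists_removal_of_card_schur_triples_lt {G : Type*} [AddCommGroup G] [Fintype G]
    [DecidableEq G] {ε : ℝ} (A : Finset G)
    (hA : (#{p ∈ A ×ˢ A | p.1 + p.2 ∈ A} : ℝ) < 27 * triangleRemovalBound ε * card G ^ 2) :
    ∃ C : Finset G, (#C : ℝ) ≤ 81 * ε * card G ∧
      ∀ a ∈ A, ∀ b ∈ A, a + b ∈ A → a ∈ C ∨ b ∈ C ∨ a + b ∈ C := by
  have hG : (0 : ℝ) < card G := by exact_mod_cast Fintype.card_pos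
  let t : Finset (G × G × G) :=
    {p | p.2.1 - p.1 ∈ A ∧ p.2.2 - p.2.1 ∈ A ∧ p.2.2 - p.1 ∈ A}
  have mem_t (x y z : G) : (x, y, z) ∈ t ↔ y - x ∈ A ∧ z - y ∈ A ∧ z - x ∈ A := by simp [t]
  have card_t : #t ≤ card G * #{p ∈ A ×ˢ A | p.1 + p.2 ∈ A} := by
    rw [← Finset.card_univ, ← card_product]
    refine card_le_card_of_injOn (fun p ↦ (p.1, p.2.1 - p.1, p.2.2 - p.2.1)) ?_ ?_
    · rintro ⟨x, y, z⟩ h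
      obtain ⟨h₁, h₂, h₃⟩ := (mem_t x y z).1 h
      simp [h₁, h₂, h₃]
    · rintro ⟨x, y, z⟩ - ⟨x', y', z'⟩ - h
      simp only [Prod.mk.injEq] at h
      obtain ⟨rfl, h₁, h₂⟩ := h
      obtain rfl := sub_left_injective h₁
      obtain rfl := sub_left_injective h₂
      rfl
  have hV : card (G ⊕ G ⊕ G) = 3 * card G := by simp only [Fintype.card_sum]; ring
  have hfar : ¬ (graph t).FarFromTriangleFree ε := by
    intro h
    have h₁ := h.le_card_cliqueFinset
    have h₂ : #((graph t).cliqueFinset 3) ≤ #t := card_cliqueFinset_graph_le <| by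
      simp only [mem_t]; tauto
    have h₃ : (#((graph t).cliqueFinset 3) : ℝ) ≤
        card G * #{p ∈ A ×ˢ A | p.1 + p.2 ∈ A} := mod_cast h₂.trans card_t
    rw [hV] at h₁
    push_cast at h₁
    nlinarith [mul_lt_mul_of_pos_left hA hG]
  unfold FarFromTriangleFree DeleteFar at hfar
  push Not at hfar
  obtain ⟨s, -, hfree, hs⟩ := hfar
  rw [hV] at hs
  push_cast at hs
  let f₀₁ : G × G → Sym2 (G ⊕ G ⊕ G) := fun p ↦ s(in₀ p.2, in₁ (p.2 + p.1))
  let f₁₂ : G × G → Sym2 (G ⊕ G ⊕ G) := fun p ↦ s(in₁ p.2, in₂ (p.2 + p.1))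
  let f₀₂ : G × G → Sym2 (G ⊕ G ⊕ G) := fun p ↦ s(in₀ p.2, in₂ (p.2 + p.1))
  have h₀₁ : ∑ a, #{x | f₀₁ (a, x) ∈ s} ≤ #s := sum_card_fiber_le_of_injective (by
    rintro ⟨a, x⟩ ⟨b, y⟩ h
    simp [f₀₁, in₀, in₁] at h
    aesop) s
  have h₁₂ : ∑ a, #{x | f₁₂ (a, x) ∈ s} ≤ #s := sum_card_fiber_le_of_injective (by
    rintro ⟨a, x⟩ ⟨b, y⟩ h
    simp [f₁₂, in₁, in₂] at h
    aesop) s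
  have h₀₂ : ∑ a, #{x | f₀₂ (a, x) ∈ s} ≤ #s := sum_card_fiber_le_of_injective (by
    rintro ⟨a, x⟩ ⟨b, y⟩ h
    simp [f₀₂, in₀, in₂] at h
    aesop) s
  let w : G → ℕ := fun a ↦
    #{x | f₀₁ (a, x) ∈ s} + #{x | f₁₂ (a, x) ∈ s} + #{x | f₀₂ (a, x) ∈ s}
  have hw : ∑ a, w a ≤ 3 * #s := by
    simp only [w, sum_add_distrib]
    lia
  refine ⟨univ.filter fun a ↦ card G ≤ 3 * w a, ?_, fun a ha b hb hab ↦ ?_⟩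
  · have h₁ : #{a | card G ≤ 3 * w a} * card G ≤ 9 * #s := by
      calc #{a | card G ≤ 3 * w a} * card G ≤ ∑ a with card G ≤ 3 * w a, 3 * w a := by
            rw [← smul_eq_mul]
            exact card_nsmul_le_sum _ _ _ (by simp)
        _ ≤ ∑ a, 3 * w a := sum_le_sum_of_subset (subset_univ _)
        _ ≤ 9 * #s := by rw [← mul_sum]; lia
    have h₂ : (#{a | card G ≤ 3 * w a} * card G : ℝ) ≤ 9 * #s := mod_cast h₁
    refine le_of_mul_le_mul_right ?_ hG
    nlinarith
  · by_contra! h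
    simp only [mem_filter, mem_univ, true_and, not_le, w] at h
    obtain ⟨ha', hb', hab'⟩ := h
    have hcover : (univ : Finset G) ⊆ ({x | f₀₁ (a, x) ∈ s} : Finset G) ∪
        ({x | f₁₂ (b, x) ∈ s} : Finset G).image (· - a) ∪
        ({x | f₀₂ (a + b, x) ∈ s} : Finset G) := by
      intro x _
      by_contra hx
      simp only [mem_union, mem_image, mem_filter, mem_univ, true_and, not_or, not_exists,
        not_and] at hx
      obtain ⟨⟨hx₀₁, hx₁₂⟩, hx₀₂⟩ := hx
      replace hx₁₂ : f₁₂ (b, x + a) ∉ s := fun h ↦ hx₁₂ _ h (by simp)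
      have hx : (x, x + a, x + (a + b)) ∈ t := by
        rw [mem_t]
        refine ⟨by simpa, ?_, by simpa⟩
        rwa [← add_assoc, add_sub_cancel_left]
      refine hfree {in₀ x, in₁ (x + a), in₂ (x + (a + b))} ?_
      rw [is3Clique_triple_iff]
      simp only [deleteEdges_adj, mem_coe]
      refine ⟨⟨Rel.in₀₁ hx, hx₀₁⟩, ⟨Rel.in₀₂ hx, hx₀₂⟩, ⟨Rel.in₁₂ hx, ?_⟩⟩
      rwa [← add_assoc]
    have h₁ := card_le_card hcover
    rw [Finset.card_univ] at h₁
    have h₂ := h₁.trans <| (card_union_le _ _).trans <|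
      add_le_add_left ((card_union_le _ _).trans <| add_le_add_right card_image_le _) _
    lia

open Finset in
theorem card_schur_triples_image_natCast_le {n : ℕ} {A : Finset ℕ} (hA : A ⊆ Icc 1 n) :
    #{p ∈ A.image (Nat.cast : ℕ → ZMod (2 * n + 1)) ×ˢ A.image Nat.cast |
      p.1 + p.2 ∈ A.image Nat.cast} ≤ schurTriples A := by
  refine (card_le_card fun p hp ↦ ?_).trans
    (card_image_le (f := fun p : ℕ × ℕ ↦ ((p.1 : ZMod (2 * n + 1)), (p.2 : ZMod (2 * n + 1)))))
  obtain ⟨x, y⟩ := p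
  simp only [mem_filter, mem_product, mem_image] at hp
  obtain ⟨⟨⟨a, ha, rfl⟩, b, hb, rfl⟩, c, hc, h⟩ := hp
  have ha' := mem_Icc.1 (hA ha)
  have hb' := mem_Icc.1 (hA hb)
  have hc' := mem_Icc.1 (hA hc)
  rw [← Nat.cast_add, ZMod.natCast_eq_natCast_iff] at h
  have habc : c = a + b := Nat.ModEq.eq_of_lt_of_lt h (by lia) (by lia)
  refine mem_image.2 ⟨(a, b), ?_, rfl⟩
  simp [ha, hb, ← habc, hc]

theorem stmt5 :
    ∀ ε : ℝ, 0 < ε → ∃ δ : ℝ, 0 < δ ∧ ∃ N : ℕ, ∀ n : ℕ, N ≤ n →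
      ∀ A : Finset ℕ, A ⊆ Finset.Icc 1 n → (schurTriples A : ℝ) ≤ δ * n ^ 2 →
        ∃ B C : Finset ℕ, A = B ∪ C ∧ SumFree B ∧ (C.card : ℝ) ≤ ε * n := by
  intro ε hε
  have hδ := SimpleGraph.triangleRemovalBound_pos (ε := ε / 243) (by positivity)
  refine ⟨_, hδ, 1, fun n hn A hA hcard ↦ ?_⟩
  have hn' : (1 : ℝ) ≤ n := mod_cast hn
  obtain ⟨C, hC, hAC⟩ := exists_removal_of_card_schur_triples_lt (ε := ε / 243)
    (A.image (Nat.cast : ℕ → ZMod (2 * n + 1))) (by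
      refine (Nat.cast_le.2 (card_schur_triples_image_natCast_le hA)).trans_lt
        (hcard.trans_lt ?_)
      rw [ZMod.card]
      push_cast
      nlinarith [mul_pos hδ (show (0 : ℝ) < n by linarith),
        mul_pos hδ (show (0 : ℝ) < n ^ 2 by positivity)])
  rw [ZMod.card] at hC
  push_cast at hC
  refine ⟨A.filter fun a : ℕ ↦ (a : ZMod (2 * n + 1)) ∉ C,
    A.filter fun a : ℕ ↦ (a : ZMod (2 * n + 1)) ∈ C, ?_, fun a ha b hb hab ↦ ?_, ?_⟩
  · rw [Finset.union_comm, Finset.filter_union_filter_not_eq]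
  · rw [Finset.mem_filter] at ha hb hab
    have := hAC a (Finset.mem_image_of_mem _ ha.1) b (Finset.mem_image_of_mem _ hb.1)
      (by rw [← Nat.cast_add]; exact Finset.mem_image_of_mem _ hab.1)
    rw [← Nat.cast_add] at this
    tauto
  · have hle : (A.filter fun a : ℕ ↦ (a : ZMod (2 * n + 1)) ∈ C).card ≤ C.card := by
      refine Finset.card_le_card_of_injOn Nat.cast (fun a ha ↦ (Finset.mem_filter.1 ha).2) ?_
      intro a ha b hb h
      have ha' := Finset.mem_Icc.1 (hA (Finset.mem_filter.1 ha).1)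
      have hb' := Finset.mem_Icc.1 (hA (Finset.mem_filter.1 hb).1)
      rw [ZMod.natCast_eq_natCast_iff] at h
      exact Nat.ModEq.eq_of_lt_of_lt h (by lia) (by lia)
    have hle' : ((A.filter fun a : ℕ ↦ (a : ZMod (2 * n + 1)) ∈ C).card : ℝ) ≤ C.card :=
      mod_cast hle
    nlinarith
end

section
/- For every ε > 0 there exist δ > 0 and N such that for all n ≥ N the following holds: if A ⊆ [n] contains at most δn² Schur triples and |A| ≥ (1/2 − 1/11)n, then at least one of the following holds: (a) the number of elements a ∈ A with a < |A| is at most εn (i.e., all but at most εn elements of A lie in the interval [|A|, n]); or (b) the number of even elements of A is at most εn. -/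
section Kneser

open Finset Pointwise

open scoped Classical in
theorem card_mul_card_le_card_inf_mul {G : Type*} [AddCommGroup G] [Fintype G] [DecidableEq G]
    (H₁ H₂ : AddSubgroup G) (V U D : Finset G) (c : G)
    (hV : ∀ v ∈ V, v ∈ H₁) (hU : ∀ u ∈ U, u ∈ H₂) (hD : ∀ v ∈ V, ∀ u ∈ U, c + v + u ∈ D) :
    #V * #U ≤ #{x : G | x ∈ H₁ ⊓ H₂} * #D := by
  rw [← card_product]
  refine card_le_mul_card_image_of_maps_to (f := fun p ↦ c + p.1 + p.2) ?_ _ ?_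
  · rintro ⟨v, u⟩ h
    rw [mem_product] at h
    exact hD v h.1 u h.2
  · intro d _
    obtain h | ⟨⟨v₀, u₀⟩, h₀⟩ := (filter (fun p ↦ c + p.1 + p.2 = d) (V ×ˢ U)).eq_empty_or_nonempty
    · simp [h]
    · refine card_le_card_of_injOn (fun p ↦ p.1 - v₀) ?_ ?_
      · rintro ⟨v, u⟩ h
        simp only [coe_filter, mem_filter, mem_product, Set.mem_ofPred_eq] at h h₀
        simp only [coe_filter, mem_univ, true_and, Set.mem_ofPred_eq, AddSubgroup.mem_inf]
        refine ⟨H₁.sub_mem (hV _ h.1.1) (hV _ h₀.1.1), ?_⟩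
        have : v - v₀ = u₀ - u := by
          have := h.2.trans h₀.2.symm
          rw [sub_eq_sub_iff_add_eq_add]
          have h3 : c + (v + u) = c + (v₀ + u₀) := by simpa [add_assoc] using this
          rw [add_left_cancel h3, add_comm]
        rw [this]
        exact H₂.sub_mem (hU _ h₀.1.2) (hU _ h.1.2)
      · rintro ⟨v, u⟩ h ⟨v', u'⟩ h' heq
        simp only [coe_filter, mem_product, Set.mem_ofPred_eq] at h h' heq
        have hv : v = v' := by simpa using heq
        subst hv
        have := h.2.trans h'.2.symm
        simpa using this

open scoped Classical in
/-- If a union of cosets of `H₁` and a union of cosets of `H₂` are both nearly the whole union,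
then a point of the second outside the first forces `H₂` to be small. -/
theorem card_le_card_sdiff_of_periodic {G : Type*} [AddCommGroup G] [Fintype G] [DecidableEq G]
    (H₁ H₂ : AddSubgroup G) (C₁ C₂ : Finset G)
    (h₁ : ∀ h ∈ H₁, ∀ x ∈ C₁, h + x ∈ C₁) (h₂ : ∀ h ∈ H₂, ∀ x ∈ C₂, h + x ∈ C₂)
    {c : G} (hc₂ : c ∈ C₂) (hc₁ : c ∉ C₁)
    (hp : #(C₂ \ C₁) + #{x : G | x ∈ H₁ ⊓ H₂} < #{x : G | x ∈ H₁})
    (hq : #(C₁ \ C₂) + #{x : G | x ∈ H₁ ⊓ H₂} < #{x : G | x ∈ H₂}) :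
    #{x : G | x ∈ H₂} ≤ #(C₂ \ C₁) := by
  have h₁' : ∀ h ∈ H₁, ∀ x, h + x ∈ C₁ → x ∈ C₁ := fun h hh x hx ↦ by
    simpa using h₁ (-h) (H₁.neg_mem hh) _ hx
  have h₂' : ∀ h ∈ H₂, ∀ x, h + x ∈ C₂ → x ∈ C₂ := fun h hh x hx ↦ by
    simpa using h₂ (-h) (H₂.neg_mem hh) _ hx
  set F₀ : Finset G := {x : G | x ∈ H₁ ⊓ H₂} with hF₀
  set F₁ : Finset G := {x : G | x ∈ H₁} with hF₁
  set F₂ : Finset G := {x : G | x ∈ H₂} with hF₂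
  have hpos : 1 ≤ #F₀ := card_pos.2 ⟨0, by simp [hF₀, zero_mem]⟩
  have e₁ := card_filter_add_card_filter_not (s := F₁) (fun v ↦ c + v ∈ C₂)
  have e₂ := card_filter_add_card_filter_not (s := F₂) (fun u ↦ c + u ∉ C₁)
  set V := F₁.filter (fun v ↦ c + v ∈ C₂) with hV
  set V' := F₁.filter (fun v ↦ ¬ c + v ∈ C₂) with hV'
  set U := F₂.filter (fun u ↦ c + u ∉ C₁) with hU
  set U' := F₂.filter (fun u ↦ ¬ c + u ∉ C₁) with hU'
  have i₁ : #V * #U ≤ #F₀ * #(C₂ \ C₁) := by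
    refine card_mul_card_le_card_inf_mul H₁ H₂ V U _ c (by simp +contextual [hV, hF₁])
      (by simp +contextual [hU, hF₂]) fun v hv u hu ↦ ?_
    simp only [hV, hU, hF₁, hF₂, mem_filter, mem_univ, true_and, mem_sdiff] at hv hu ⊢
    refine ⟨?_, fun h ↦ hu.2 (h₁' v hv.1 _ ?_)⟩
    · rw [add_comm]; exact h₂ _ hu.1 _ hv.2
    · convert h using 1; abel
  have i₂ : #V' * #U' ≤ #F₀ * #(C₁ \ C₂) := by
    refine card_mul_card_le_card_inf_mul H₁ H₂ V' U' _ c (by simp +contextual [hV', hF₁])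
      (by simp +contextual [hU', hF₂]) fun v hv u hu ↦ ?_
    simp only [hV', hU', hF₁, hF₂, mem_filter, mem_univ, true_and, mem_sdiff, not_not] at hv hu ⊢
    refine ⟨?_, fun h ↦ hv.2 (h₂' u hu.1 _ ?_)⟩
    · rw [add_right_comm, add_comm]; exact h₁ _ hv.1 _ hu.2
    · convert h using 1; abel
  have j₁ : #F₀ ≤ #V := card_le_card fun x hx ↦ by
    simp only [hV, hF₀, hF₁, mem_filter, mem_univ, true_and, AddSubgroup.mem_inf] at hx ⊢
    exact ⟨hx.1, by rw [add_comm]; exact h₂ _ hx.2 _ hc₂⟩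
  have j₂ : #F₀ ≤ #U := card_le_card fun x hx ↦ by
    simp only [hU, hF₀, hF₂, mem_filter, mem_univ, true_and, AddSubgroup.mem_inf] at hx ⊢
    exact ⟨hx.2, fun h ↦ hc₁ (h₁' x hx.1 _ (by rwa [add_comm]))⟩
  have j₃ : #V' = 0 ∨ #F₀ ≤ #V' := by
    obtain h | ⟨y, hy⟩ := V'.eq_empty_or_nonempty
    · simp [h]
    · refine .inr (card_le_card_of_injOn (fun x ↦ x + y) (fun x hx ↦ ?_) (by simp))
      simp only [hV', hF₀, hF₁, coe_filter, mem_filter, mem_univ, true_and, AddSubgroup.mem_inf,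
        Set.mem_ofPred_eq] at hx hy ⊢
      refine ⟨H₁.add_mem hx.1 hy.1, fun h ↦ hy.2 (h₂' x hx.2 _ ?_)⟩
      convert h using 1; abel
  have j₄ : #U' = 0 ∨ #F₀ ≤ #U' := by
    obtain h | ⟨y, hy⟩ := U'.eq_empty_or_nonempty
    · simp [h]
    · refine .inr (card_le_card_of_injOn (fun x ↦ x + y) (fun x hx ↦ ?_) (by simp))
      simp only [hU', hF₀, hF₂, coe_filter, mem_filter, mem_univ, true_and, AddSubgroup.mem_inf,
        Set.mem_ofPred_eq, not_not] at hx hy ⊢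
      refine ⟨H₂.add_mem hx.2 hy.1, ?_⟩
      rw [add_left_comm]; exact h₁ _ hx.1 _ hy.2
  generalize #F₀ = f at *
  generalize #F₁ = f₁ at *
  generalize #F₂ = f₂ at *
  generalize #V = v at *
  generalize #V' = v' at *
  generalize #U = u at *
  generalize #U' = u' at *
  generalize #(C₂ \ C₁) = p at *
  generalize #(C₁ \ C₂) = q at *
  clear_value V V' U U' F₀ F₁ F₂
  rcases j₃ with rfl | j₃
  · have : f * v ≤ f * p := by nlinarith
    have := Nat.le_of_mul_le_mul_left this hpos
    omega
  rcases j₄ with rfl | j₄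
  · have : f * u ≤ f * p := by nlinarith
    have := Nat.le_of_mul_le_mul_left this hpos
    omega
  obtain ⟨s, rfl⟩ := Nat.exists_eq_add_of_le j₁
  obtain ⟨t, rfl⟩ := Nat.exists_eq_add_of_le j₂
  obtain ⟨s', rfl⟩ := Nat.exists_eq_add_of_le j₃
  obtain ⟨t', rfl⟩ := Nat.exists_eq_add_of_le j₄
  exfalso
  have k₁ : p + 1 ≤ f + s + s' := by omega
  have k₂ : q + 1 ≤ f + t + t' := by omega
  have := Nat.mul_le_mul_left f k₁
  have := Nat.mul_le_mul_left f k₂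
  nlinarith [Nat.zero_le (s * t), Nat.zero_le (s' * t')]

open scoped Classical in
/-- Kneser's lemma on unions of two periodic sets. -/
theorem exists_period_union {G : Type*} [AddCommGroup G] [Fintype G] [DecidableEq G] (N : ℕ)
    (C₁ C₂ : Finset G)
    (h₁ : ∃ H : AddSubgroup G, (∀ h ∈ H, ∀ x ∈ C₁, h + x ∈ C₁) ∧ N ≤ #C₁ + #{x : G | x ∈ H})
    (h₂ : ∃ H : AddSubgroup G, (∀ h ∈ H, ∀ x ∈ C₂, h + x ∈ C₂) ∧ N ≤ #C₂ + #{x : G | x ∈ H}) :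
    ∃ H : AddSubgroup G, (∀ h ∈ H, ∀ x ∈ C₁ ∪ C₂, h + x ∈ C₁ ∪ C₂) ∧
      N ≤ #(C₁ ∪ C₂) + #{x : G | x ∈ H} := by
  by_cases s₁ : C₂ ⊆ C₁
  · rwa [union_eq_left.2 s₁]
  by_cases s₂ : C₁ ⊆ C₂
  · rwa [union_eq_right.2 s₂]
  obtain ⟨H₁, p₁, n₁⟩ := h₁
  obtain ⟨H₂, p₂, n₂⟩ := h₂
  obtain ⟨c, hc₂, hc₁⟩ := not_subset.1 s₁
  obtain ⟨d, hd₁, hd₂⟩ := not_subset.1 s₂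
  refine ⟨H₁ ⊓ H₂, fun h hh x hx ↦ ?_, ?_⟩
  · rw [mem_union] at hx ⊢
    exact hx.imp (p₁ h hh.1 x) (p₂ h hh.2 x)
  · have e₁ : #(C₁ ∪ C₂) = #C₁ + #(C₂ \ C₁) := by
      rw [← union_sdiff_self_eq_union, card_union_of_disjoint disjoint_sdiff]
    have e₂ : #(C₁ ∪ C₂) = #C₂ + #(C₁ \ C₂) := by
      rw [union_comm, ← union_sdiff_self_eq_union, card_union_of_disjoint disjoint_sdiff]
    by_contra! hlt
    have a₁ := card_le_card_sdiff_of_periodic H₁ H₂ C₁ C₂ p₁ p₂ hc₂ hc₁ (by omega) (by omega)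
    have a₂ := card_le_card_sdiff_of_periodic H₂ H₁ C₂ C₁ p₂ p₁ hd₁ hd₂
      (by rw [inf_comm]; omega) (by rw [inf_comm]; omega)
    omega

open scoped Classical in
theorem exists_periodic_subset_add {G : Type*} [AddCommGroup G] [Fintype G] [DecidableEq G]
    (n : ℕ) :
    ∀ A B : Finset G, #B = n → 0 ∈ A → 0 ∈ B →
      ∃ C ⊆ A + B, 0 ∈ C ∧ ∃ H : AddSubgroup G, (∀ h ∈ H, ∀ x ∈ C, h + x ∈ C) ∧
        #A + #B ≤ #C + #{x : G | x ∈ H} := by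
  induction n using Nat.strong_induction_on with
  | _ n ih =>
  intro A B hn hA hB
  by_cases hAB : ∀ e ∈ A, ∀ b ∈ B, b + e ∈ A
  · refine ⟨A, fun a ha ↦ mem_add.2 ⟨a, ha, 0, hB, add_zero a⟩, hA,
      AddSubgroup.closure B, fun h hh ↦ ?_, ?_⟩
    · have hstab : AddSubgroup.closure (B : Set G) ≤ AddAction.stabilizer G A := by
        rw [AddSubgroup.closure_le]
        intro b hb
        rw [SetLike.mem_coe, AddAction.mem_stabilizer_iff]
        refine eq_of_subset_of_card_le ?_ (by simp)
        intro x hx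
        obtain ⟨y, hy, rfl⟩ := mem_vadd_finset.1 hx
        exact hAB y hy b hb
      intro x hx
      have := AddAction.mem_stabilizer_iff.1 (hstab hh)
      rw [← this]
      exact mem_vadd_finset.2 ⟨x, hx, rfl⟩
    · gcongr
      intro b hb
      simpa using AddSubgroup.subset_closure hb
  · push Not at hAB
    obtain ⟨e, he, b, hb, hbe⟩ := hAB
    have hinj : Function.Injective (fun x ↦ x + e) := add_left_injective e
    set A' := A ∪ B.image (fun x ↦ x + e) with hA'
    set B' := B.filter (fun x ↦ x + e ∈ A) with hB'
    have hcard : #A' + #B' = #A + #B := by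
      have h1 := card_union_add_card_inter A (B.image (fun x ↦ x + e))
      rw [card_image_of_injective _ hinj] at h1
      have h2 : A ∩ B.image (fun x ↦ x + e) = B'.image (fun x ↦ x + e) := by
        ext x
        simp only [hB', mem_inter, mem_image, mem_filter]
        constructor
        · rintro ⟨hx, y, hy, rfl⟩
          exact ⟨y, ⟨hy, hx⟩, rfl⟩
        · rintro ⟨y, ⟨hy, hx⟩, rfl⟩
          exact ⟨hx, y, hy, rfl⟩
      rw [h2, card_image_of_injective _ hinj] at h1
      exact h1
    have hlt : #B' < n := by
      rw [← hn]
      exact card_lt_card ⟨filter_subset _ _, fun h ↦ hbe (mem_filter.1 (h hb)).2⟩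
    obtain ⟨C, hC, h0, H, hH, hc⟩ := ih _ hlt A' B' rfl (mem_union_left _ hA)
      (mem_filter.2 ⟨hB, by simpa using he⟩)
    refine ⟨C, hC.trans ?_, h0, H, hH, by omega⟩
    intro x hx
    obtain ⟨a, ha, y, hy, rfl⟩ := mem_add.1 hx
    rw [hB', mem_filter] at hy
    rcases mem_union.1 ha with ha | ha
    · exact add_mem_add ha hy.1
    · obtain ⟨z, hz, rfl⟩ := mem_image.1 ha
      have := add_mem_add hy.2 hz
      convert this using 1
      abel

open scoped Classical in
/-- **Kneser's theorem**: a sumset `A + B` in a finite abelian group has a period `H` with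
`|A| + |B| ≤ |A + B| + |H|`. -/
theorem exists_period_add {G : Type*} [AddCommGroup G] [Fintype G] [DecidableEq G] {A B : Finset G}
    (hA : A.Nonempty) (hB : B.Nonempty) :
    ∃ H : AddSubgroup G, (∀ h ∈ H, ∀ x ∈ A + B, h + x ∈ A + B) ∧
      #A + #B ≤ #(A + B) + #{x : G | x ∈ H} := by
  have key : ∀ x ∈ A + B, ∃ C ⊆ A + B, x ∈ C ∧ ∃ H : AddSubgroup G,
      (∀ h ∈ H, ∀ x ∈ C, h + x ∈ C) ∧ #A + #B ≤ #C + #{x : G | x ∈ H} := by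
    intro x hx
    obtain ⟨a, ha, b, hb, rfl⟩ := mem_add.1 hx
    obtain ⟨C, hC, h0, H, hH, hc⟩ := exists_periodic_subset_add _ (-a +ᵥ A) (-b +ᵥ B) rfl
      (mem_vadd_finset.2 ⟨a, ha, by simp⟩) (mem_vadd_finset.2 ⟨b, hb, by simp⟩)
    refine ⟨(a + b) +ᵥ C, ?_, mem_vadd_finset.2 ⟨0, h0, by simp⟩, H, ?_, by simpa using hc⟩
    · intro y hy
      obtain ⟨z, hz, rfl⟩ := mem_vadd_finset.1 hy
      obtain ⟨u, hu, v, hv, rfl⟩ := mem_add.1 (hC hz)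
      obtain ⟨u, hu', rfl⟩ := mem_vadd_finset.1 hu
      obtain ⟨v, hv', rfl⟩ := mem_vadd_finset.1 hv
      have e : (a + b) + ((-a + u) + (-b + v)) = u + v := by abel
      have e' := add_mem_add hu' hv'
      rwa [← e] at e'
    · intro h hh y hy
      obtain ⟨z, hz, rfl⟩ := mem_vadd_finset.1 hy
      refine mem_vadd_finset.2 ⟨h + z, hH h hh z hz, ?_⟩
      simp only [vadd_eq_add]; abel
  choose! C hC hxC hper using key
  have hunion : ∀ s : Finset G, s.Nonempty → s ⊆ A + B → ∃ H : AddSubgroup G,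
      (∀ h ∈ H, ∀ x ∈ s.biUnion C, h + x ∈ s.biUnion C) ∧
        #A + #B ≤ #(s.biUnion C) + #{x : G | x ∈ H} := by
    intro s hs
    induction hs using Finset.Nonempty.cons_induction with
    | singleton a =>
      intro h
      rw [singleton_biUnion]
      exact hper a (by simpa using h)
    | cons a s ha hs ih =>
      intro h
      rw [cons_eq_insert, biUnion_insert]
      rw [cons_eq_insert, insert_subset_iff] at h
      exact exists_period_union _ _ _ (hper a h.1) (ih h.2)
  have := hunion (A + B) (hA.add hB) subset_rfl
  have heq : (A + B).biUnion C = A + B := by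
    apply Subset.antisymm
    · exact biUnion_subset.2 hC
    · exact fun x hx ↦ mem_biUnion.2 ⟨x, hx, hxC x hx⟩
  rwa [heq] at this

open scoped Classical in
theorem card_filter_mk_eq {G : Type*} [AddCommGroup G] [Fintype G] [DecidableEq G]
    (H : AddSubgroup G) (c : G ⧸ H) :
    #{x : G | (x : G ⧸ H) = c} = #{x : G | x ∈ H} := by
  obtain ⟨y, rfl⟩ := QuotientAddGroup.mk_surjective c
  rw [← card_image_of_injective {x : G | x ∈ H} (add_right_injective y)]
  congr 1
  ext x
  simp only [mem_filter, mem_univ, true_and, mem_image]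
  rw [eq_comm, QuotientAddGroup.eq]
  exact ⟨fun h ↦ ⟨_, h, by abel⟩, by rintro ⟨z, hz, rfl⟩; simpa using hz⟩

open scoped Classical in
theorem card_filter_mk_mem {G : Type*} [AddCommGroup G] [Fintype G] [DecidableEq G]
    (H : AddSubgroup G)
    (J : Finset (G ⧸ H)) : #{x : G | (x : G ⧸ H) ∈ J} = #J * #{x : G | x ∈ H} := by
  rw [← sum_card_fiberwise_eq_card_filter, sum_congr rfl fun c _ ↦ card_filter_mk_eq H c, sum_const,
    smul_eq_mul]

open scoped Classical in
/-- If `H` is the stabilizer of `S - S`, then Kneser's theorem controls the image of `S` in the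
quotient by `H`. -/
theorem two_mul_card_image_mk_le {G : Type*} [AddCommGroup G] [Fintype G] [DecidableEq G]
    {S : Finset G}
    (hS : S.Nonempty) (H : AddSubgroup G)
    (hH : ∀ h, h ∈ H ↔ ∀ x ∈ S - S, h + x ∈ S - S) (J : Finset (G ⧸ H))
    (hJ : J = S.image (QuotientAddGroup.mk : G → G ⧸ H)) :
    2 * #J ≤ #(J - J) + 1 ∧ (∀ x : G, (x : G ⧸ H) ∈ J - J → x ∈ S - S) ∧
      #(S - S) = #(J - J) * #{x : G | x ∈ H} := by
  have hper : ∀ x y : G, (x : G ⧸ H) = y → x ∈ S - S → y ∈ S - S := by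
    intro x y hxy hx
    rw [QuotientAddGroup.eq] at hxy
    simpa using (hH _).1 hxy x hx
  have hT : ∀ x : G, (x : G ⧸ H) ∈ J - J ↔ x ∈ S - S := by
    intro x
    constructor
    · intro hx
      obtain ⟨c, hc, d, hd, hcd⟩ := mem_sub.1 hx
      rw [hJ] at hc hd
      obtain ⟨s, hs, rfl⟩ := mem_image.1 hc
      obtain ⟨t, ht, rfl⟩ := mem_image.1 hd
      exact hper (s - t) x hcd (sub_mem_sub hs ht)
    · intro hx
      obtain ⟨s, hs, t, ht, rfl⟩ := mem_sub.1 hx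
      rw [hJ]
      exact sub_mem_sub (mem_image_of_mem _ hs) (mem_image_of_mem _ ht)
  set S' : Finset G := {x : G | (x : G ⧸ H) ∈ J} with hS'
  have hSS' : S ⊆ S' := fun s hs ↦ by simpa [hS', hJ] using ⟨s, hs, rfl⟩
  have hsub : S' + -S' = S - S := by
    rw [← sub_eq_add_neg]
    refine Subset.antisymm (fun d hd ↦ ?_) (sub_subset_sub hSS' hSS')
    obtain ⟨x, hx, y, hy, rfl⟩ := mem_sub.1 hd
    rw [← hT]
    simp only [hS', mem_filter, mem_univ, true_and] at hx hy
    exact sub_mem_sub hx hy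
  have hcT : #(S - S) = #(J - J) * #{x : G | x ∈ H} := by
    rw [← card_filter_mk_mem]
    congr 1
    ext x
    simp [hT]
  refine ⟨?_, fun x ↦ (hT x).1, hcT⟩
  obtain ⟨K, hK, hcK⟩ := exists_period_add (hS.mono hSS') (hS.mono hSS').neg
  rw [hsub] at hK hcK
  have hKH : #{x : G | x ∈ K} ≤ #{x : G | x ∈ H} :=
    card_le_card fun x hx ↦ by
      simp only [mem_filter, mem_univ, true_and] at hx ⊢
      exact (hH x).2 (hK x hx)
  rw [card_neg, hcT, hS', card_filter_mk_mem] at hcK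
  have hpos : 0 < #{x : G | x ∈ H} := card_pos.2 ⟨0, by simp [H.zero_mem]⟩
  refine Nat.le_of_mul_le_mul_right ?_ hpos
  linarith

end Kneser

section SumFree

open Finset Pointwise

theorem card_sub_le_two_mul_card_pos (A : Finset ℤ) :
    #(A - A) ≤ 2 * #{d ∈ A - A | 0 < d} + 1 := by
  set D := {d ∈ A - A | 0 < d} with hD
  have : A - A ⊆ insert 0 (D ∪ D.image (fun d ↦ -d)) := by
    intro d hd
    simp only [mem_insert, mem_union, mem_image, hD, mem_filter]
    rcases lt_trichotomy d 0 with h | h | h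
    · refine .inr (.inr ⟨-d, ⟨?_, by omega⟩, by omega⟩)
      obtain ⟨a, ha, b, hb, rfl⟩ := mem_sub.1 hd
      exact mem_sub.2 ⟨b, hb, a, ha, by omega⟩
    · exact .inl h
    · exact .inr (.inl ⟨hd, h⟩)
  have h₁ := card_le_card this
  have h₂ := card_insert_le 0 (D ∪ D.image (fun d ↦ -d))
  have h₃ := card_union_le D (D.image (fun d ↦ -d))
  have h₄ := card_image_le (s := D) (f := fun d ↦ -d)
  omega

theorem disjoint_pos_sub_of_sumFree {A : Finset ℤ} (hsf : ∀ x ∈ A, ∀ y ∈ A, x + y ∉ A) :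
    Disjoint {d ∈ A - A | 0 < d} A := by
  rw [disjoint_left]
  intro d hd hdA
  obtain ⟨a, ha, b, hb, rfl⟩ := mem_sub.1 (mem_filter.1 hd).1
  exact hsf b hb _ hdA (by simpa using ha)

theorem card_sub_add_two_mul_card_le {A : Finset ℤ} {m M : ℤ} (hm : 1 ≤ m)
    (hA : A ⊆ Icc m M) (hsf : ∀ x ∈ A, ∀ y ∈ A, x + y ∉ A) (hne : A.Nonempty) :
    (#(A - A) : ℤ) + 2 * #A ≤ 2 * M + 1 := by
  have h₁ := card_sub_le_two_mul_card_pos A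
  have h₂ : {d ∈ A - A | 0 < d} ∪ A ⊆ Icc 1 M := by
    refine union_subset (fun d hd ↦ ?_) (hA.trans (Icc_subset_Icc_left hm))
    rw [mem_filter] at hd
    obtain ⟨a, ha, b, hb, rfl⟩ := mem_sub.1 hd.1
    have := mem_Icc.1 (hA ha)
    have := mem_Icc.1 (hA hb)
    rw [mem_Icc]; omega
  have h₃ := card_le_card h₂
  rw [card_union_of_disjoint (disjoint_pos_sub_of_sumFree hsf), Int.card_Icc] at h₃
  obtain ⟨a, ha⟩ := hne
  have := mem_Icc.1 (hA ha)
  omega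

/-- A sum-free set contained in `[m, 3 * m)` and containing `m` has at most `m` elements. -/
theorem card_le_of_lt_three_mul {A : Finset ℤ} {m M : ℤ} (hm : 1 ≤ m) (hmA : m ∈ A)
    (hA : A ⊆ Icc m M) (hsf : ∀ x ∈ A, ∀ y ∈ A, x + y ∉ A) (hM : M < 3 * m) : (#A : ℤ) ≤ m := by
  have : #A ≤ #(Ico 0 m) := by
    refine card_le_card_of_injOn (fun x ↦ x % m) (fun x _ ↦ ?_) ?_
    · simp only [coe_Ico, Set.mem_Ico]
      exact ⟨Int.emod_nonneg _ (by omega), Int.emod_lt_of_pos _ (by omega)⟩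
    · have key : ∀ x ∈ A, ∀ y ∈ A, x % m = y % m → x ≤ y := by
        intro x hx y hy hxy
        by_contra! hlt
        obtain ⟨c, hc⟩ : m ∣ x - y := Int.ModEq.dvd hxy.symm
        have := mem_Icc.1 (hA hx)
        have := mem_Icc.1 (hA hy)
        have h₁ : 0 < c := by nlinarith
        have h₂ : c < 2 := by nlinarith
        obtain rfl : c = 1 := by omega
        exact hsf _ hy _ hmA (by rwa [show y + m = x by omega])
      intro x hx y hy hxy
      exact le_antisymm (key x hx y hy hxy) (key y hy x hx hxy.symm)
  rw [Int.card_Ico] at this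
  omega

theorem card_le_min_of_card_inter_le {A : Finset ℤ} {m M n : ℤ} (hm : 1 ≤ m) (hmA : m ∈ A)
    (hA : A ⊆ Icc m M) (hsf : ∀ x ∈ A, ∀ y ∈ A, x + y ∉ A)
    (hn : 101 ≤ n) (hM : M ≤ n) (hk : 51 * n ≤ 125 * #A)
    (hb : 2 * (#{a ∈ A | a ≤ M - m} : ℤ) + #A ≤ M - m + 2) : (#A : ℤ) ≤ m := by
  by_contra! hlt
  have h3 : 3 * m ≤ M := by
    by_contra! h
    exact hlt.not_ge (card_le_of_lt_three_mul hm hmA hA hsf h)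
  have e₁ := card_filter_add_card_filter_not (s := A) (fun a ↦ a ≤ M - m)
  set A₁ := {a ∈ A | a ≤ M - m} with hA₁
  set A₂ := {a ∈ A | ¬ a ≤ M - m} with hA₂
  have e₂ := card_filter_add_card_filter_not (s := Ioc (M - m) M) (fun a ↦ a ∈ A)
  have e₃ : {a ∈ Ioc (M - m) M | a ∈ A} = A₂ := by
    ext a
    simp only [hA₂, mem_filter, mem_Ioc]
    constructor
    · rintro ⟨h, h'⟩; exact ⟨h', by omega⟩
    · rintro ⟨h, h'⟩; exact ⟨⟨by omega, (mem_Icc.1 (hA h)).2⟩, h⟩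
  rw [e₃, Int.card_Ioc] at e₂
  set R := {a ∈ Ioc (M - m) M | ¬ a ∈ A} with hR
  have e₄ := card_filter_add_card_filter_not (s := A₁) (fun a ↦ a ≤ M - 2 * m)
  set B := {a ∈ A₁ | a ≤ M - 2 * m} with hB
  have e₅ : #{a ∈ A₁ | ¬ a ≤ M - 2 * m} ≤ #R := by
    refine card_le_card_of_injOn (fun a ↦ a + m) (fun a ha ↦ ?_) (by simp)
    simp only [coe_filter, hA₁, mem_filter, Set.mem_ofPred_eq, hR, mem_Ioc] at ha ⊢
    exact ⟨by omega, hsf _ ha.1.1 _ hmA⟩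
  have e₆ : Icc (M - m + 1) (M - m + min m (2 * #A + m - M - 2)) ⊆ R := by
    intro s hs
    simp only [mem_Icc, hR, mem_filter, mem_Ioc] at hs ⊢
    have hs₂ := hs.2
    refine ⟨by omega, fun hsA ↦ ?_⟩
    have hdis : Disjoint B (B.image (fun x ↦ s - x)) := by
      rw [disjoint_left]
      intro x hx hx'
      obtain ⟨y, hy, rfl⟩ := mem_image.1 hx'
      simp only [hB, hA₁, mem_filter] at hx hy
      exact hsf _ hx.1.1 _ hy.1.1 (by simpa using hsA)
    have hsub : B ∪ B.image (fun x ↦ s - x) ⊆ Icc m (s - m) := by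
      refine union_subset (fun x hx ↦ ?_) (fun x hx ↦ ?_)
      · simp only [hB, hA₁, mem_filter] at hx
        have := mem_Icc.1 (hA hx.1.1)
        rw [mem_Icc]; omega
      · obtain ⟨y, hy, rfl⟩ := mem_image.1 hx
        simp only [hB, hA₁, mem_filter] at hy
        have := mem_Icc.1 (hA hy.1.1)
        rw [mem_Icc]; omega
    have := card_le_card hsub
    rw [card_union_of_disjoint hdis, card_image_of_injective _ sub_right_injective,
      Int.card_Icc] at this
    omega
  have e₇ := card_le_card e₆
  rw [Int.card_Icc] at e₇
  omega

theorem false_of_even {A : Finset ℤ} {m M n : ℤ} (hm : 1 ≤ m) (hMA : M ∈ A)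
    (hA : A ⊆ Icc m M) (hsf : ∀ x ∈ A, ∀ y ∈ A, x + y ∉ A)
    (hn : 101 ≤ n) (hM : M ≤ n) (hk : 51 * n ≤ 125 * #A) (he : ∀ a ∈ A, Even a) : False := by
  have hdis : Disjoint A ((A.erase M).image (fun x ↦ M - x)) := by
    rw [disjoint_left]
    intro x hx hx'
    obtain ⟨y, hy, rfl⟩ := mem_image.1 hx'
    exact hsf _ hx _ (mem_erase.1 hy).2 (by simpa using hMA)
  have hmem : ∀ x ∈ A ∪ (A.erase M).image (fun x ↦ M - x), 1 ≤ x ∧ x ≤ M ∧ x % 2 = 0 := by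
    intro x hx
    have hM2 := Int.even_iff.1 (he M hMA)
    rcases mem_union.1 hx with hx | hx
    · have := mem_Icc.1 (hA hx)
      exact ⟨by omega, by omega, Int.even_iff.1 (he x hx)⟩
    · obtain ⟨y, hy, rfl⟩ := mem_image.1 hx
      rw [mem_erase] at hy
      have := mem_Icc.1 (hA hy.2)
      have := Int.even_iff.1 (he y hy.2)
      omega
  have hcard : #(A ∪ (A.erase M).image (fun x ↦ M - x)) ≤ #(Icc 1 (M / 2)) := by
    refine card_le_card_of_injOn (fun x ↦ x / 2) (fun x hx ↦ ?_) (fun x hx y hy hxy ↦ ?_)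
    · have := hmem x hx
      simp only [coe_Icc, Set.mem_Icc]
      omega
    · have := hmem x hx
      have := hmem y hy
      simp only at hxy
      omega
  rw [card_union_of_disjoint hdis, card_image_of_injective _ sub_right_injective,
    card_erase_of_mem hMA, Int.card_Icc] at hcard
  omega

/-- Removing the differences `a - M` keeps every residue modulo `M - m`. -/
theorem card_image_add_card_le {A : Finset ℤ} {m M : ℤ} {ℓ : ℕ} (hmA : m ∈ A) (hMA : M ∈ A)
    (hA : A ⊆ Icc m M) (hℓ : (ℓ : ℤ) = M - m) :
    #((A - A).image (Int.cast : ℤ → ZMod ℓ)) + (#A - 1) ≤ #(A - A) := by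
  set R := (A.erase M).image (fun a ↦ a - M) with hR
  have hRA : R ⊆ A - A := by
    intro r hr
    obtain ⟨a, ha, rfl⟩ := mem_image.1 hr
    exact sub_mem_sub (mem_of_mem_erase ha) hMA
  have hRc : #R = #A - 1 := by
    rw [hR, card_image_of_injective _ sub_left_injective, card_erase_of_mem hMA]
  have hsub : (A - A).image (Int.cast : ℤ → ZMod ℓ) ⊆ ((A - A) \ R).image Int.cast := by
    intro x hx
    obtain ⟨d, hd, rfl⟩ := mem_image.1 hx
    by_cases hdR : d ∈ R
    · obtain ⟨a, ha, rfl⟩ := mem_image.1 hdR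
      rw [mem_erase] at ha
      refine mem_image.2 ⟨a - m, mem_sdiff.2 ⟨sub_mem_sub ha.2 hmA, fun h ↦ ?_⟩, ?_⟩
      · obtain ⟨b, hb, hab⟩ := mem_image.1 h
        rw [mem_erase] at hb
        have := mem_Icc.1 (hA hb.2)
        have := mem_Icc.1 (hA ha.2)
        omega
      · rw [show a - m = a - M + ℓ by omega]
        simp
    · exact mem_image_of_mem _ (mem_sdiff.2 ⟨hd, hdR⟩)
  have h₁ := (card_le_card hsub).trans card_image_le
  rw [card_sdiff_of_subset hRA] at h₁
  have := card_le_card hRA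
  omega

theorem injOn_erase_cast {A : Finset ℤ} {m M : ℤ} {ℓ : ℕ}
    (hA : A ⊆ Icc m M) (hℓ : (ℓ : ℤ) = M - m) :
    Set.InjOn (Int.cast : ℤ → ZMod ℓ) (A.erase M) := by
  intro x hx y hy hxy
  rw [mem_coe, mem_erase] at hx hy
  have hx' := mem_Icc.1 (hA hx.2)
  have hy' := mem_Icc.1 (hA hy.2)
  have h := (ZMod.intCast_eq_intCast_iff_dvd_sub _ _ _).1 hxy
  obtain ⟨c, hc⟩ := h
  have h₁ : c < 1 := by
    by_contra!
    nlinarith [lt_of_le_of_ne hx'.2 hx.1, lt_of_le_of_ne hy'.2 hy.1]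
  have h₂ : -1 < c := by
    by_contra!
    nlinarith [lt_of_le_of_ne hx'.2 hx.1, lt_of_le_of_ne hy'.2 hy.1]
  obtain rfl : c = 0 := by omega
  omega

/-- Counting differences class by class along a homomorphism `φ` whose classes are nearly full. -/
theorem three_mul_card_le_card_sub_s6 {Q : Type*} [AddCommGroup Q] [DecidableEq Q] (φ : ℤ →+ Q)
    {A Δ : Finset ℤ}
    {h : ℕ} (hΔ : A - A ⊆ Δ) (hx : ∀ c, #{a ∈ A | φ a = c} ≤ h)
    (hN : ∀ e ∈ A.image φ - A.image φ, h ≤ #{d ∈ Δ | φ d = e})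
    (hJ : 2 ≤ #(A.image φ))
    (hE : 2 * #(A.image φ) ≤ #(A.image φ - A.image φ) + 1) :
    3 * #A ≤ #Δ + 2 * #(A.image φ) := by
  set J := A.image φ with hJd
  set x : Q → ℕ := fun c ↦ #{a ∈ A | φ a = c} with hxd
  set N : Q → ℕ := fun e ↦ #{d ∈ Δ | φ d = e} with hNd
  have hsum : ∑ c ∈ J, x c = #A :=
    (card_eq_sum_card_fiberwise fun a ha ↦ mem_image_of_mem φ ha).symm
  have hpos : ∀ c ∈ J, {a ∈ A | φ a = c}.Nonempty := by
    intro c hc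
    obtain ⟨a, ha, rfl⟩ := mem_image.1 hc
    exact ⟨a, mem_filter.2 ⟨ha, rfl⟩⟩
  have hxx : ∀ c ∈ J, ∀ c' ∈ J, x c + x c' ≤ N (c - c') + 1 := by
    intro c hc c' hc'
    have h₁ := cauchy_davenport_add_of_linearOrder_isCancelAdd (hpos c hc) (hpos c' hc').neg
    have h₂ : {a ∈ A | φ a = c} + -{a ∈ A | φ a = c'} ⊆ {d ∈ Δ | φ d = c - c'} := by
      intro d hd
      rw [← sub_eq_add_neg] at hd
      obtain ⟨a, ha, b, hb, rfl⟩ := mem_sub.1 hd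
      rw [mem_filter] at ha hb
      exact mem_filter.2 ⟨hΔ (sub_mem_sub ha.1 hb.1), by rw [map_sub, ha.2, hb.2]⟩
    have h₃ := card_le_card h₂
    rw [card_neg] at h₁
    simp only [hxd, hNd]
    omega
  obtain ⟨c₁, hc₁, hmax⟩ := exists_max_image J x (card_pos.1 (by omega))
  have hJx : #A ≤ #J * x c₁ := by
    rw [← hsum, ← smul_eq_mul]
    exact sum_le_card_nsmul _ _ _ hmax
  set I := J.image (fun c ↦ c₁ - c) with hI
  have hIE : I ⊆ J - J := by
    intro e he
    obtain ⟨c, hc, rfl⟩ := mem_image.1 he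
    exact sub_mem_sub hc₁ hc
  have hIc : #I = #J := card_image_of_injective _ sub_right_injective
  have hΔN : ∑ e ∈ J - J, N e ≤ #Δ := by
    exact (sum_card_fiberwise_eq_card_filter Δ (J - J) φ).trans_le (card_filter_le _ _)
  rw [← sum_sdiff hIE] at hΔN
  have hI₁ : #J * x c₁ + #A ≤ ∑ e ∈ I, N e + #J := by
    rw [hI, sum_image (fun a _ b _ hab ↦ sub_right_injective hab), ← hsum]
    calc _ = ∑ c ∈ J, (x c₁ + x c) := by rw [sum_add_distrib, sum_const, smul_eq_mul]
      _ ≤ ∑ c ∈ J, (N (c₁ - c) + 1) := sum_le_sum fun c hc ↦ hxx _ hc₁ _ hc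
      _ = _ := by rw [sum_add_distrib, sum_const, smul_eq_mul, mul_one]
  have hdc : #J ≤ #((J - J) \ I) + 1 := by
    rw [card_sdiff_of_subset hIE]; omega
  have hI₂ : ∀ w, (∀ e ∈ (J - J) \ I, w ≤ N e) → (#J - 1) * w ≤ ∑ e ∈ (J - J) \ I, N e := by
    intro w hw
    refine le_trans ?_ (card_nsmul_le_sum _ _ _ hw)
    rw [smul_eq_mul]
    gcongr
    omega
  have hpair : ∀ e ∈ (J - J) \ I, 2 * h + #A ≤ N e + 1 + #J * h := by
    intro e he
    rw [mem_sdiff] at he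
    obtain ⟨c, hc, c', hc', rfl⟩ := mem_sub.1 he.1
    have hne : c ≠ c' := by
      rintro rfl
      exact he.2 (mem_image.2 ⟨c₁, hc₁, by simp⟩)
    have h₁ := hxx c hc c' hc'
    have h₂ : #A + 2 * h ≤ x c + x c' + #J * h := by
      rw [← hsum, ← add_sum_erase _ _ hc,
        ← add_sum_erase (J.erase c) _ (mem_erase.2 ⟨hne.symm, hc'⟩)]
      have h₃ := sum_le_card_nsmul ((J.erase c).erase c') x h fun c _ ↦ hx c
      rw [card_erase_of_mem (mem_erase.2 ⟨hne.symm, hc'⟩), card_erase_of_mem hc, smul_eq_mul] at h₃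
      obtain ⟨j, hj⟩ := Nat.exists_eq_add_of_le hJ
      rw [hj] at h₃ ⊢
      rw [show 2 + j - 1 - 1 = j by omega] at h₃
      linarith
    omega
  obtain ⟨j, hj⟩ := Nat.exists_eq_add_of_le hJ
  have hAh : #A ≤ #J * h := by
    rw [← hsum, ← smul_eq_mul]
    exact sum_le_card_nsmul _ _ _ fun c _ ↦ hx c
  have hj1 : #J - 1 = j + 1 := by omega
  rw [hj1] at hI₂
  rw [hj] at hI₁ hJx hAh hpair ⊢
  rcases le_or_gt ((2 + j) * h) (h + #A) with hm | hm
  · obtain ⟨d, hd⟩ := Nat.exists_eq_add_of_le hm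
    have := hI₂ (h + d - 1) fun e he ↦ by have := hpair e he; omega
    have h₁ : (j + 1) * (h + d) ≤ (j + 1) * (h + d - 1) + (j + 1) := by
      rw [← Nat.mul_succ]
      gcongr
      omega
    nlinarith [Nat.zero_le (j * d)]
  · have := hI₂ h fun e he ↦ hN e (mem_sdiff.1 he).1
    nlinarith

open scoped Classical in
/-- The case where the differences do not cover all residues modulo `ℓ`. -/
theorem forall_odd_of_image_sub_ne_univ {n m M : ℤ} {ℓ : ℕ} [NeZero ℓ] {A : Finset ℤ}
    (hn : 3000 ≤ n) (hm : 1 ≤ m) (hM : M ≤ n) (hmA : m ∈ A) (hMA : M ∈ A) (hA : A ⊆ Icc m M)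
    (hsf : ∀ x ∈ A, ∀ y ∈ A, x + y ∉ A) (hk : 51 * n ≤ 125 * #A) (hℓ : (ℓ : ℤ) = M - m)
    (hT : (A - A).image (Int.castAddHom (ZMod ℓ)) ≠ univ) : ∀ a ∈ A, Odd a := by
  have hΔ := card_sub_add_two_mul_card_le hm hA hsf ⟨m, hmA⟩
  have hlift : #((A - A).image (Int.castAddHom (ZMod ℓ))) + (#A - 1) ≤ #(A - A) :=
    card_image_add_card_le hmA hMA hA hℓ
  set A₀ := A.erase M with hA₀
  have hA₀c : #A₀ = #A - 1 := card_erase_of_mem hMA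
  have hℓ0 : 0 < ℓ := Nat.pos_of_ne_zero (NeZero.ne ℓ)
  have hmA₀ : m ∈ A₀ := mem_erase.2 ⟨by omega, hmA⟩
  have hinj : Set.InjOn (Int.castAddHom (ZMod ℓ)) A₀ := injOn_erase_cast hA hℓ
  have hMm : Int.castAddHom (ZMod ℓ) M = Int.castAddHom (ZMod ℓ) m := by
    rw [show M = m + ℓ by omega]; simp
  have hAA₀ : A.image (Int.castAddHom (ZMod ℓ)) = A₀.image (Int.castAddHom (ZMod ℓ)) := by
    rw [← insert_erase hMA, image_insert, ← hA₀, insert_eq_of_mem]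
    rw [hMm]
    exact mem_image_of_mem _ hmA₀
  set S := A₀.image (Int.castAddHom (ZMod ℓ)) with hS
  have hAS : (A - A).image (Int.castAddHom (ZMod ℓ)) = S - S := by
    rw [← hAA₀]
    exact image_image₂_distrib (map_sub (Int.castAddHom (ZMod ℓ)))
  rw [hAS] at hT hlift
  have hSne : S.Nonempty := ⟨_, mem_image_of_mem _ hmA₀⟩
  obtain ⟨H, hH⟩ : ∃ H : AddSubgroup (ZMod ℓ), ∀ h, h ∈ H ↔ ∀ x ∈ S - S, h + x ∈ S - S := by
    refine ⟨AddAction.stabilizer (ZMod ℓ) (S - S), fun h ↦ ?_⟩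
    rw [AddAction.mem_stabilizer_iff]
    constructor
    · intro hh x hx
      rw [← hh]
      exact mem_vadd_finset.2 ⟨x, hx, rfl⟩
    · intro hh
      refine eq_of_subset_of_card_le (fun x hx ↦ ?_) (by simp)
      obtain ⟨y, hy, rfl⟩ := mem_vadd_finset.1 hx
      exact hh y hy
  let mk : ZMod ℓ →+ ZMod ℓ ⧸ H := QuotientAddGroup.mk' H
  let φ : ℤ →+ ZMod ℓ ⧸ H := mk.comp (Int.castAddHom (ZMod ℓ))
  have hJ : A₀.image φ = S.image (QuotientAddGroup.mk : ZMod ℓ → ZMod ℓ ⧸ H) := by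
    rw [hS, image_image]; rfl
  obtain ⟨hE, hlifts, hTc⟩ := two_mul_card_image_mk_le hSne H hH _ hJ
  set J := A₀.image φ with hJd
  set h := #{x : ZMod ℓ | x ∈ H} with hhd
  have hhpos : 0 < h := card_pos.2 ⟨0, by simp [H.zero_mem]⟩
  have hfib : ∀ c, #{a ∈ A₀ | φ a = c} ≤ h := by
    intro c
    rw [hhd, ← card_filter_mk_eq H c]
    refine card_le_card_of_injOn _ (fun a ha ↦ ?_) (hinj.mono (fun a ha ↦ (mem_filter.1 ha).1))
    simp only [coe_filter, Set.mem_ofPred_eq, mem_univ, true_and] at ha ⊢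
    exact ha.2
  have hA₀J : #A₀ ≤ #J * h := by
    rw [card_eq_sum_card_fiberwise fun a ha ↦ mem_image_of_mem φ ha, ← smul_eq_mul]
    exact sum_le_card_nsmul _ _ _ fun c _ ↦ hfib c
  have hQ : Fintype.card (ZMod ℓ ⧸ H) * h = ℓ := by
    rw [hhd, ← card_univ, ← card_filter_mk_mem]
    simp [ZMod.card]
  have hJQ : #J ≤ Fintype.card (ZMod ℓ ⧸ H) := card_le_univ J
  have hJpos : 0 < #J := card_pos.2 ⟨_, mem_image_of_mem φ hmA₀⟩
  rcases Nat.lt_or_ge (#J) 2 with hJ1 | hJ2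
  · have hJ1' : #J = 1 := by omega
    have hker : ∀ a ∈ A, φ (a - m) = 0 := by
      intro a ha
      have ha' : φ a ∈ J := by
        rw [hJ, ← hAA₀, image_image]
        exact mem_image_of_mem (fun a : ℤ ↦ φ a) ha
      rw [map_sub, sub_eq_zero]
      exact card_le_one.1 hJ1'.le _ ha' _ (mem_image_of_mem φ hmA₀)
    have hQ1 : Fintype.card (ZMod ℓ ⧸ H) ≠ 1 := by
      intro hQ1
      have := Fintype.card_le_one_iff_subsingleton.1 hQ1.le
      refine hT (eq_univ_of_forall fun x ↦ hlifts x ?_)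
      rw [Subsingleton.elim (x : ZMod ℓ ⧸ H) (φ m - φ m)]
      exact sub_mem_sub (mem_image_of_mem φ hmA₀) (mem_image_of_mem φ hmA₀)
    have hQ2 : Fintype.card (ZMod ℓ ⧸ H) = 2 := by
      have : Fintype.card (ZMod ℓ ⧸ H) < 3 := by
        by_contra! h3
        have : 3 * h ≤ ℓ := by rw [← hQ]; gcongr
        rw [hJ1'] at hA₀J
        omega
      omega
    have hsurj : Function.Surjective φ :=
      (QuotientAddGroup.mk'_surjective H).comp ZMod.intCast_surjective
    have h2 : φ 1 + φ 1 = 0 := by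
      rw [← two_nsmul, ← hQ2]
      exact card_nsmul_eq_zero
    have h1 : φ 1 ≠ 0 := by
      intro h1
      have hz : ∀ q : ZMod ℓ ⧸ H, q = 0 := by
        intro q
        obtain ⟨z, rfl⟩ := hsurj q
        rw [← mul_one z, ← smul_eq_mul, map_zsmul, h1, smul_zero]
      exact hQ1 (Fintype.card_eq_one_iff.2 ⟨0, hz⟩)
    have heven : ∀ a ∈ A, Even (a - m) := by
      intro a ha
      by_contra hodd
      obtain ⟨z, hz⟩ := Int.not_even_iff_odd.1 hodd
      refine h1 ?_
      have := hker a ha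
      rwa [hz, map_add, two_mul, map_add, ← map_add, ← mul_two, ← smul_eq_mul, map_zsmul,
        show (2 : ℤ) = 1 + 1 from rfl, map_add, h2, smul_zero, zero_add] at this
    rcases Int.even_or_odd m with hme | hmo
    · exfalso
      refine false_of_even hm hMA hA hsf (by omega) hM hk fun a ha ↦ ?_
      simpa using (heven a ha).add hme
    · intro a ha
      simpa using (heven a ha).add_odd hmo
  · by_cases hsmall : 20 * h ≤ #A
    · exfalso
      have : #J * h * 2 ≤ (#(J - J) + 1) * h := by nlinarith
      rw [add_mul, ← hTc] at this
      omega
    · exfalso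
      have hN : ∀ e ∈ J - J, h ≤ #{d ∈ A - A | φ d = e} := by
        intro e he
        rw [hhd, ← card_filter_mk_eq H e]
        have : ({x : ZMod ℓ | (x : ZMod ℓ ⧸ H) = e} : Finset (ZMod ℓ)) ⊆
            {d ∈ A - A | φ d = e}.image (Int.castAddHom (ZMod ℓ)) := by
          intro x hx
          simp only [mem_filter, mem_univ, true_and] at hx
          have hxT := hlifts x (hx ▸ he)
          rw [← hAS] at hxT
          obtain ⟨d, hd, rfl⟩ := mem_image.1 hxT
          exact mem_image_of_mem _ (mem_filter.2 ⟨hd, hx⟩)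
        exact (card_le_card this).trans card_image_le
      have := three_mul_card_le_card_sub_s6 φ (sub_subset_sub (erase_subset M A) (erase_subset M A))
        hfib hN hJ2 hE
      rw [← hA₀, ← hJd, hA₀c] at this
      have hJ50 : #J < 50 := by
        by_contra! h50
        have : 50 * h ≤ ℓ := by rw [← hQ]; gcongr; omega
        omega
      omega

open scoped Classical in
theorem forall_odd_or_card_le_of_sumFree {n : ℤ} {A : Finset ℤ} (hn : 3000 ≤ n) (hA : A ⊆ Icc 1 n)
    (hsf : ∀ x ∈ A, ∀ y ∈ A, x + y ∉ A) (hk : 51 * n ≤ 125 * #A) :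
    (∀ a ∈ A, Odd a) ∨ ∀ a ∈ A, (#A : ℤ) ≤ a := by
  have hne : A.Nonempty := card_pos.1 (by omega)
  obtain ⟨m, hmA, hmin⟩ := exists_min_image A id hne
  obtain ⟨M, hMA, hmax⟩ := exists_max_image A id hne
  have hAI : A ⊆ Icc m M := fun a ha ↦ mem_Icc.2 ⟨hmin a ha, hmax a ha⟩
  have hm := (mem_Icc.1 (hA hmA)).1
  have hM := (mem_Icc.1 (hA hMA)).2
  have hc := card_le_card hAI
  rw [Int.card_Icc] at hc
  obtain ⟨ℓ, hℓ⟩ := Int.eq_ofNat_of_zero_le (show 0 ≤ M - m by omega)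
  have : NeZero ℓ := ⟨by omega⟩
  by_cases hT : (A - A).image (Int.castAddHom (ZMod ℓ)) = univ
  · right
    suffices (#A : ℤ) ≤ m from fun a ha ↦ this.trans (hmin a ha)
    refine card_le_min_of_card_inter_le hm hmA hAI hsf (by omega) hM hk ?_
    have hlift : #((A - A).image (Int.castAddHom (ZMod ℓ))) + (#A - 1) ≤ #(A - A) :=
      card_image_add_card_le hmA hMA hAI hℓ.symm
    rw [hT, card_univ, ZMod.card] at hlift
    have h₁ := card_sub_le_two_mul_card_pos A
    have h₂ : {d ∈ A - A | 0 < d} ∪ {a ∈ A | a ≤ M - m} ⊆ Icc 1 (M - m) := by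
      refine union_subset (fun d hd ↦ ?_) (fun a ha ↦ ?_)
      · rw [mem_filter] at hd
        obtain ⟨a, ha, b, hb, rfl⟩ := mem_sub.1 hd.1
        have := mem_Icc.1 (hAI ha)
        have := mem_Icc.1 (hAI hb)
        rw [mem_Icc]; omega
      · rw [mem_filter] at ha
        have := mem_Icc.1 (hAI ha.1)
        rw [mem_Icc]; omega
    have h₃ := card_le_card h₂
    rw [card_union_of_disjoint ((disjoint_pos_sub_of_sumFree hsf).mono_right (filter_subset _ _)),
      Int.card_Icc] at h₃
    omega
  · exact .inl (forall_odd_of_image_sub_ne_univ hn hm hM hmA hMA hAI hsf hk hℓ.symm hT)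

end SumFree

section Removal

open Finset SimpleGraph SimpleGraph.TripartiteFromTriangles

theorem zmod_cast_inj {n a b : ℕ} (ha : a ≤ 2 * n) (hb : b ≤ 2 * n)
    (h : (a : ZMod (2 * n + 1)) = b) : a = b := by
  rw [ZMod.natCast_eq_natCast_iff] at h
  exact Nat.ModEq.eq_of_lt_of_lt h (by omega) (by omega)

/-- Edge-disjoint Schur triples give edge-disjoint triangles in a Cayley-type tripartite graph, so
the triangle removal lemma bounds their number. -/
theorem triangleRemovalBound_mul_le_schurTriples {n : ℕ} {A : Finset ℕ} (hA : A ⊆ Icc 1 n)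
    {F : Finset (ℕ × ℕ)} (hF : ∀ p ∈ F, p.1 ∈ A ∧ p.2 ∈ A ∧ p.1 + p.2 ∈ A)
    (h₁ : Set.InjOn Prod.fst (F : Set (ℕ × ℕ))) (h₂ : Set.InjOn Prod.snd (F : Set (ℕ × ℕ)))
    (h₃ : Set.InjOn (fun p ↦ p.1 + p.2) (F : Set (ℕ × ℕ))) {ε : ℝ}
    (hε : ε * (9 * (2 * n + 1)) ≤ #F) :
    triangleRemovalBound ε * 27 * (2 * n + 1) ^ 2 ≤ schurTriples A := by
  have hA' : ∀ a ∈ A, a ≤ n := fun a ha ↦ (mem_Icc.1 (hA ha)).2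
  let Z := ZMod (2 * n + 1)
  have hZ : Fintype.card Z = 2 * n + 1 := ZMod.card _
  let f : Z × ℕ × ℕ → Z × Z × Z := fun p ↦ (p.1, p.1 + p.2.1, p.1 + p.2.1 + p.2.2)
  set t : Finset (Z × Z × Z) := (univ ×ˢ F).image f with ht
  have hmem : ∀ a b c : Z, (a, b, c) ∈ t ↔ ∃ x y : ℕ, (x, y) ∈ F ∧ b - a = x ∧ c - b = y := by
    intro a b c
    simp only [ht, f, mem_image, mem_product, mem_univ, true_and, Prod.exists, Prod.mk.injEq]
    constructor
    · rintro ⟨_, x, y, h, rfl, rfl, rfl⟩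
      exact ⟨x, y, h, by ring, by ring⟩
    · rintro ⟨x, y, h, hx, hy⟩
      exact ⟨a, x, y, h, rfl, by rw [← hx]; ring, by rw [← hx, ← hy]; ring⟩
  have hinj : Set.InjOn f (univ ×ˢ F : Finset (Z × ℕ × ℕ)) := by
    rintro ⟨v, x, y⟩ h ⟨v', x', y'⟩ h' heq
    simp only [coe_product, Set.mem_prod, mem_coe] at h h'
    simp only [f, Prod.mk.injEq] at heq
    obtain ⟨rfl, hx, hy⟩ := heq
    obtain rfl : x = x' := zmod_cast_inj (by linarith [hA' _ (hF _ h.2).1])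
      (by linarith [hA' _ (hF _ h'.2).1]) (add_left_cancel hx)
    obtain rfl : y = y' := zmod_cast_inj (by linarith [hA' _ (hF _ h.2).2.1])
      (by linarith [hA' _ (hF _ h'.2).2.1]) (add_left_cancel hy)
    rfl
  have hcard : #t = (2 * n + 1) * #F := by
    rw [ht, card_image_of_injOn hinj, card_product, card_univ, hZ]
  have hdisj : ExplicitDisjoint t := by
    constructor
    · intro a b c a' h h'
      obtain ⟨x, y, hp, hx, hy⟩ := (hmem _ _ _).1 h
      obtain ⟨x', y', hp', hx', hy'⟩ := (hmem _ _ _).1 h'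
      have e := zmod_cast_inj (by linarith [hA' _ (hF _ hp).2.1])
        (by linarith [hA' _ (hF _ hp').2.1]) (hy.symm.trans hy')
      have := congrArg Prod.fst (h₂ hp hp' e)
      simp only at this
      subst this
      exact sub_right_injective (hx.trans hx'.symm)
    · intro a b c b' h h'
      obtain ⟨x, y, hp, hx, hy⟩ := (hmem _ _ _).1 h
      obtain ⟨x', y', hp', hx', hy'⟩ := (hmem _ _ _).1 h'
      have e : ((x + y : ℕ) : Z) = (x' + y' : ℕ) := by
        rw [Nat.cast_add, Nat.cast_add, ← hx, ← hy, ← hx', ← hy']; ring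
      have e := zmod_cast_inj (by linarith [hA' _ (hF _ hp).2.2])
        (by linarith [hA' _ (hF _ hp').2.2]) e
      have := congrArg Prod.fst (h₃ hp hp' e)
      simp only at this
      subst this
      exact sub_left_injective (hx.trans hx'.symm)
    · intro a b c c' h h'
      obtain ⟨x, y, hp, hx, hy⟩ := (hmem _ _ _).1 h
      obtain ⟨x', y', hp', hx', hy'⟩ := (hmem _ _ _).1 h'
      have e := zmod_cast_inj (by linarith [hA' _ (hF _ hp).1])
        (by linarith [hA' _ (hF _ hp').1]) (hx.symm.trans hx')
      have := congrArg Prod.snd (h₁ hp hp' e)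
      simp only at this
      subst this
      exact sub_left_injective (hy.trans hy'.symm)
  have hfar : (graph t).FarFromTriangleFree ε := by
    apply farFromTriangleFree
    rw [hcard, hZ]
    push_cast
    nlinarith [(by positivity : (0 : ℝ) ≤ 2 * n + 1)]
  have hle := hfar.le_card_cliqueFinset
  have htri : #((graph t).cliqueFinset 3) ≤ (2 * n + 1) * schurTriples A := by
    set T := (A ×ˢ A).filter (fun p => p.1 + p.2 ∈ A) with hT
    have : (graph t).cliqueFinset 3 ⊆
        ((univ : Finset Z) ×ˢ T).image (fun p ↦ toTriangle (f p)) := by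
      intro s hs
      rw [mem_cliqueFinset_iff, SimpleGraph.is3Clique_iff] at hs
      obtain ⟨x, y, z, hxy, hxz, hyz, rfl⟩ := hs
      obtain ⟨a, b, c, habc, hab, hac, hbc⟩ := graph_triple hxy hxz hyz
      obtain ⟨c', hc'⟩ := Graph.in₀₁_iff.1 hab
      obtain ⟨b', hb'⟩ := Graph.in₀₂_iff.1 hac
      obtain ⟨a', ha'⟩ := Graph.in₁₂_iff.1 hbc
      obtain ⟨x₁, y₁, hp₁, hx₁, -⟩ := (hmem _ _ _).1 hc'
      obtain ⟨x₂, y₂, hp₂, hx₂, hy₂⟩ := (hmem _ _ _).1 hb'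
      obtain ⟨x₃, y₃, hp₃, -, hy₃⟩ := (hmem _ _ _).1 ha'
      have e : ((x₁ + y₃ : ℕ) : Z) = (x₂ + y₂ : ℕ) := by
        rw [Nat.cast_add, Nat.cast_add, ← hx₁, ← hy₃, ← hx₂, ← hy₂]; ring
      have e := zmod_cast_inj (by linarith [hA' _ (hF _ hp₁).1, hA' _ (hF _ hp₃).2.1])
        (by linarith [hA' _ (hF _ hp₂).2.2]) e
      refine mem_image.2 ⟨(a, x₁, y₃), ?_, ?_⟩
      · simp only [hT, mem_product, mem_univ, true_and, mem_filter]
        exact ⟨⟨(hF _ hp₁).1, (hF _ hp₃).2.1⟩, by rw [e]; exact (hF _ hp₂).2.2⟩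
      · rw [← habc]
        simp only [f, ← hx₁, ← hy₃, toTriangle_apply, add_sub_cancel]
    refine (card_le_card this).trans (card_image_le.trans ?_)
    rw [card_product, card_univ, hZ]
    rfl
  have hle' := hle.trans (Nat.cast_le.2 htri)
  simp only [Fintype.card_sum, hZ] at hle'
  push_cast at hle'
  have hpos : (0 : ℝ) < 2 * n + 1 := by positivity
  refine le_of_mul_le_mul_left ?_ hpos
  linarith

theorem exists_sumFree_subset_of_schurTriples_le {η : ℝ} (hη : 0 < η) :
    ∃ δ : ℝ, 0 < δ ∧ ∀ n : ℕ, 1 ≤ n → ∀ A ⊆ Icc 1 n, (schurTriples A : ℝ) ≤ δ * n ^ 2 →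
      ∃ B ⊆ A, (#(A \ B) : ℝ) ≤ η * n ∧ ∀ x ∈ B, ∀ y ∈ B, x + y ∉ B := by
  refine ⟨triangleRemovalBound (η / 81), triangleRemovalBound_pos (by positivity), ?_⟩
  intro n hn A hA hs
  classical
  set T := (A ×ˢ A).filter (fun p ↦ p.1 + p.2 ∈ A) with hT
  obtain ⟨F, hF, hmax⟩ := exists_max_image (T.powerset.filter fun F : Finset (ℕ × ℕ) ↦
    Set.InjOn Prod.fst (F : Set (ℕ × ℕ)) ∧ Set.InjOn Prod.snd (F : Set (ℕ × ℕ)) ∧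
      Set.InjOn (fun p ↦ p.1 + p.2) (F : Set (ℕ × ℕ))) card ⟨∅, by simp⟩
  rw [mem_filter, mem_powerset] at hF
  obtain ⟨hFT, h₁, h₂, h₃⟩ := hF
  have hFA : ∀ p ∈ F, p.1 ∈ A ∧ p.2 ∈ A ∧ p.1 + p.2 ∈ A := fun p hp ↦ by
    simpa [hT, and_assoc] using hFT hp
  set R := F.image Prod.fst ∪ F.image Prod.snd ∪ F.image (fun p ↦ p.1 + p.2) with hR
  refine ⟨A \ R, sdiff_subset, ?_, ?_⟩
  · have hRF : #(A \ (A \ R)) ≤ 3 * #F := by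
      rw [sdiff_sdiff_right_self]
      refine (card_le_card inter_subset_right).trans ((card_union_le _ _).trans ?_)
      have := card_union_le (F.image Prod.fst) (F.image Prod.snd)
      have := card_image_le (s := F) (f := Prod.fst)
      have := card_image_le (s := F) (f := Prod.snd)
      have := card_image_le (s := F) (f := fun p ↦ p.1 + p.2)
      omega
    have hn' : (1 : ℝ) ≤ n := by exact_mod_cast hn
    have hRF' : (#(A \ (A \ R)) : ℝ) ≤ 3 * #F := by exact_mod_cast hRF
    by_contra! hlt
    have hb := triangleRemovalBound_mul_le_schurTriples hA hFA h₁ h₂ h₃ (ε := η / 81)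
      (by nlinarith)
    have := triangleRemovalBound_pos (ε := η / 81) (by positivity)
    have : triangleRemovalBound (η / 81) * n ^ 2 < triangleRemovalBound (η / 81) *
      (27 * (2 * n + 1) ^ 2) := mul_lt_mul_of_pos_left (by nlinarith) this
    linarith
  · intro x hx y hy hxy
    rw [mem_sdiff] at hx hy hxy
    have hnot : (x, y) ∉ F := fun h ↦ hx.2 (by
      rw [hR, mem_union, mem_union]; exact .inl (.inl (mem_image_of_mem _ h)))
    have := hmax (insert (x, y) F) (by
      simp only [hR, mem_union, not_or] at hx hy hxy
      rw [mem_filter, mem_powerset, coe_insert, Set.injOn_insert (by simpa using hnot),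
        Set.injOn_insert (by simpa using hnot), Set.injOn_insert (by simpa using hnot)]
      refine ⟨insert_subset (by simp [hT, hx.1, hy.1, hxy.1]) hFT, ⟨h₁, ?_⟩, ⟨h₂, ?_⟩, ⟨h₃, ?_⟩⟩
      · rw [← coe_image]; exact hx.2.1.1
      · rw [← coe_image]; exact hy.2.1.2
      · rw [← coe_image]; exact hxy.2.2)
    rw [card_insert_of_notMem hnot] at this
    omega

end Removal

theorem stmt6 :
    ∀ ε : ℝ, 0 < ε → ∃ δ : ℝ, 0 < δ ∧ ∃ N : ℕ, ∀ n : ℕ, N ≤ n →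
      ∀ A : Finset ℕ, A ⊆ Finset.Icc 1 n →
        (schurTriples A : ℝ) ≤ δ * n ^ 2 →
        (1 / 2 - 1 / 11 : ℝ) * n ≤ A.card →
        (((A.filter (fun a => a < A.card)).card : ℝ) ≤ ε * n ∨
         ((A.filter (fun a => Even a)).card : ℝ) ≤ ε * n) := by
  intro ε hε
  obtain ⟨δ, hδ, hrem⟩ :=
    exists_sumFree_subset_of_schurTriples_le (η := min (ε / 2) (1 / 1000)) (by positivity)
  refine ⟨δ, hδ, 3000, fun n hn A hA hs hcard ↦ ?_⟩
  obtain ⟨B, hBA, hAB, hsf⟩ := hrem n (by omega) A hA hs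
  have hn₀ : (0 : ℝ) ≤ n := by positivity
  have h₁ : ((A \ B).card : ℝ) ≤ ε / 2 * n := hAB.trans (by gcongr; exact min_le_left _ _)
  have h₂ : ((A \ B).card : ℝ) ≤ 1 / 1000 * n := hAB.trans (by gcongr; exact min_le_right _ _)
  have h₃ : (A \ B).card + B.card = A.card := Finset.card_sdiff_add_card_eq_card hBA
  have h₃' : ((A \ B).card : ℝ) + B.card = A.card := by exact_mod_cast h₃
  have hk : 51 * n ≤ 125 * B.card := by
    have : (51 : ℝ) * n ≤ 125 * B.card := by linarith
    exact_mod_cast this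
  have hcast : (B.map Nat.castEmbedding : Finset ℤ).card = B.card := Finset.card_map _
  have hstruct := forall_odd_or_card_le_of_sumFree (n := n) (A := B.map Nat.castEmbedding)
    (by omega) (fun z hz ↦ by
      obtain ⟨b, hb, rfl⟩ := Finset.mem_map.1 hz
      have := Finset.mem_Icc.1 (hA (hBA hb))
      simpa using this)
    (fun x hx y hy hxy ↦ by
      obtain ⟨a, ha, rfl⟩ := Finset.mem_map.1 hx
      obtain ⟨b, hb, rfl⟩ := Finset.mem_map.1 hy
      obtain ⟨c, hc, hcab⟩ := Finset.mem_map.1 hxy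
      simp only [Nat.castEmbedding_apply] at hcab
      exact hsf a ha b hb (by rwa [show a + b = c by omega]))
    (by omega)
  simp only [Finset.forall_mem_map, Nat.castEmbedding_apply, hcast, Nat.cast_le,
    Int.odd_coe_nat] at hstruct
  rcases hstruct with hodd | hle
  · right
    have hsub : A.filter (fun a => Even a) ⊆ A \ B := fun a ha ↦ by
      rw [Finset.mem_filter] at ha
      exact Finset.mem_sdiff.2 ⟨ha.1, fun hb ↦ Nat.not_even_iff_odd.2 (hodd a hb) ha.2⟩
    have h₄ : ((A.filter (fun a => Even a)).card : ℝ) ≤ (A \ B).card := by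
      exact_mod_cast Finset.card_le_card hsub
    nlinarith
  · left
    have hsub : A.filter (fun a => a < A.card) ⊆ A \ B ∪ Finset.Ico B.card A.card := fun a ha ↦ by
      rw [Finset.mem_filter] at ha
      rw [Finset.mem_union, Finset.mem_sdiff, Finset.mem_Ico]
      by_cases hb : a ∈ B
      · exact .inr ⟨hle a hb, ha.2⟩
      · exact .inl ⟨ha.1, hb⟩
    have h₄ := (Finset.card_le_card hsub).trans (Finset.card_union_le _ _)
    rw [Nat.card_Ico] at h₄
    have h₅ : ((A.filter (fun a => a < A.card)).card : ℝ) ≤ 2 * (A \ B).card := by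
      exact_mod_cast (by omega : (A.filter (fun a => a < A.card)).card ≤ 2 * (A \ B).card)
    linarith
end

section
/- Every finite simple graph G on n vertices has at most 3^{n/3} maximal independent sets, i.e., MIS(G) ≤ 3^{n/3}. -/
/-- A finset of vertices is independent in `G` if it spans no edges. -/
def IsIndep {V : Type*} (G : SimpleGraph V) (s : Finset V) : Prop :=
  ∀ x ∈ s, ∀ y ∈ s, ¬ G.Adj x y

/-- A maximal independent set: independent, and no outside vertex can be added. -/
def IsMaxIndep {V : Type*} [DecidableEq V] (G : SimpleGraph V) (s : Finset V) : Prop :=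
  IsIndep G s ∧ ∀ v : V, v ∉ s → ¬ IsIndep G (insert v s)

/-- The number of maximal independent sets in `G`. -/
noncomputable def MIS {V : Type*} [DecidableEq V] (G : SimpleGraph V) : ℕ :=
  {s : Finset V | IsMaxIndep G s}.ncard

open scoped Finset

open Classical in
/-- The maximal independent sets of the subgraph of `G` induced on the finset `S`. -/
noncomputable def maxIndepIn {V : Type*} (G : SimpleGraph V) (S : Finset V) :
    Finset (Finset V) :=
  {s ∈ S.powerset | IsIndep G s ∧ ∀ v ∈ S, v ∉ s → ∃ x ∈ s, G.Adj x v}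

open Classical in
/-- The closed neighbourhood of `v` in the subgraph of `G` induced on the finset `S`. -/
noncomputable def closedNbhdIn {V : Type*} (G : SimpleGraph V) (S : Finset V) (v : V) :
    Finset V :=
  {x ∈ S | x = v ∨ G.Adj v x}

theorem mem_maxIndepIn {V : Type*} {G : SimpleGraph V} {S s : Finset V} :
    s ∈ maxIndepIn G S ↔ s ⊆ S ∧ IsIndep G s ∧ ∀ v ∈ S, v ∉ s → ∃ x ∈ s, G.Adj x v := by
  simp [maxIndepIn]

theorem mem_closedNbhdIn {V : Type*} {G : SimpleGraph V} {S : Finset V} {v x : V} :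
    x ∈ closedNbhdIn G S v ↔ x ∈ S ∧ (x = v ∨ G.Adj v x) := by
  simp [closedNbhdIn]

theorem cube_le_three_pow (k : ℕ) : k ^ 3 ≤ 3 ^ k := by
  rcases lt_or_ge k 3 with h | h
  · interval_cases k <;> norm_num
  · induction k, h using Nat.le_induction with
    | base => norm_num
    | succ k hk ih =>
      rw [pow_succ 3 k]
      nlinarith [mul_le_mul hk hk (by norm_num) (by positivity), mul_le_mul_left hk (k ^ 2)]

theorem natCast_le_three_rpow_div_three (k : ℕ) : (k : ℝ) ≤ (3 : ℝ) ^ ((k : ℝ) / 3) := by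
  have h : (k : ℝ) ^ 3 ≤ (3 : ℝ) ^ k := by exact_mod_cast cube_le_three_pow k
  refine le_of_pow_le_pow_left₀ (n := 3) (by norm_num) (by positivity) (h.trans_eq ?_)
  rw [← Real.rpow_mul_natCast (by norm_num), ← Real.rpow_natCast]
  congr 1
  push_cast
  ring

theorem card_maxIndepIn_mem_le {V : Type*} [DecidableEq V] (G : SimpleGraph V) (S : Finset V)
    (w : V) : #{s ∈ maxIndepIn G S | w ∈ s} ≤ #(maxIndepIn G (S \ closedNbhdIn G S w)) := by
  refine Finset.card_le_card_of_injOn (fun s => s.erase w) ?_ ?_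
  · intro s hs
    rw [Finset.mem_coe, Finset.mem_filter, mem_maxIndepIn] at hs
    rw [Finset.mem_coe, mem_maxIndepIn]
    obtain ⟨⟨hsS, hind, hmax⟩, hw⟩ := hs
    refine ⟨?_, ?_, ?_⟩
    · intro x hx
      have hx' := Finset.mem_erase.1 hx
      have := hind w hw x hx'.2
      have := hsS hx'.2
      simp_all [mem_closedNbhdIn]
    · exact fun x hx y hy => hind x (Finset.mem_of_mem_erase hx) y (Finset.mem_of_mem_erase hy)
    · intro v hv hvs
      simp only [Finset.mem_sdiff, mem_closedNbhdIn, not_and, not_or] at hv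
      obtain ⟨hvS, hv⟩ := hv
      obtain ⟨hvw, hadj⟩ := hv hvS
      obtain ⟨x, hx, hxv⟩ := hmax v hvS fun h => hvs (Finset.mem_erase.2 ⟨hvw, h⟩)
      exact ⟨x, Finset.mem_erase.2 ⟨fun h => hadj (h ▸ hxv), hx⟩, hxv⟩
  · intro s hs t ht hst
    rw [Finset.mem_coe, Finset.mem_filter] at hs ht
    rw [← Finset.insert_erase hs.2, ← Finset.insert_erase ht.2]
    exact congrArg (insert w) hst

theorem maxIndepIn_subset_biUnion {V : Type*} [DecidableEq V] (G : SimpleGraph V) {S : Finset V}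
    {v : V} (hv : v ∈ S) :
    maxIndepIn G S ⊆ (closedNbhdIn G S v).biUnion fun w => {s ∈ maxIndepIn G S | w ∈ s} := by
  intro s hs
  simp only [Finset.mem_biUnion, Finset.mem_filter, hs, true_and]
  simp only [mem_maxIndepIn, mem_closedNbhdIn] at hs ⊢
  by_cases h : v ∈ s
  · exact ⟨v, ⟨hv, Or.inl rfl⟩, h⟩
  · obtain ⟨x, hx, hxv⟩ := hs.2.2 v hv h
    exact ⟨x, ⟨hs.1 hx, Or.inr hxv.symm⟩, hx⟩

theorem card_maxIndepIn_le {V : Type*} [DecidableEq V] (G : SimpleGraph V) (S : Finset V) :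
    (#(maxIndepIn G S) : ℝ) ≤ (3 : ℝ) ^ ((#S : ℝ) / 3) := by
  induction S using Finset.strongInduction with
  | H S ih =>
  rcases S.eq_empty_or_nonempty with rfl | hne
  · have h : #(maxIndepIn G (∅ : Finset V)) ≤ 1 := by
      classical exact (Finset.card_filter_le _ _).trans (by simp)
    simpa using h
  obtain ⟨v, hv, hmin⟩ := S.exists_min_image (fun v => #(closedNbhdIn G S v)) hne
  have hsub (w : V) : closedNbhdIn G S w ⊆ S := fun _ hx => (mem_closedNbhdIn.1 hx).1
  have hbound : ∀ w ∈ closedNbhdIn G S v, (#{s ∈ maxIndepIn G S | w ∈ s} : ℝ) ≤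
      (3 : ℝ) ^ (((#S : ℝ) - #(closedNbhdIn G S v)) / 3) := by
    intro w hw
    have hwS := hsub v hw
    have hww : w ∈ closedNbhdIn G S w := mem_closedNbhdIn.2 ⟨hwS, Or.inl rfl⟩
    calc (#{s ∈ maxIndepIn G S | w ∈ s} : ℝ)
        ≤ #(maxIndepIn G (S \ closedNbhdIn G S w)) := by
          exact_mod_cast card_maxIndepIn_mem_le G S w
      _ ≤ (3 : ℝ) ^ ((#(S \ closedNbhdIn G S w) : ℝ) / 3) :=
          ih _ (Finset.sdiff_ssubset (hsub w) ⟨w, hww⟩)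
      _ ≤ _ := by
          rw [Finset.cast_card_sdiff (hsub w)]
          have := hmin w hwS
          gcongr
          norm_num
  calc (#(maxIndepIn G S) : ℝ)
      ≤ ∑ w ∈ closedNbhdIn G S v, (#{s ∈ maxIndepIn G S | w ∈ s} : ℝ) := by
        exact_mod_cast (Finset.card_le_card (maxIndepIn_subset_biUnion G hv)).trans
          Finset.card_biUnion_le
    _ ≤ #(closedNbhdIn G S v) * (3 : ℝ) ^ (((#S : ℝ) - #(closedNbhdIn G S v)) / 3) := by
        simpa using Finset.sum_le_sum hbound
    _ ≤ (3 : ℝ) ^ ((#(closedNbhdIn G S v) : ℝ) / 3) *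
          (3 : ℝ) ^ (((#S : ℝ) - #(closedNbhdIn G S v)) / 3) := by
        gcongr
        exact natCast_le_three_rpow_div_three _
    _ = (3 : ℝ) ^ ((#S : ℝ) / 3) := by
        rw [← Real.rpow_add (by norm_num)]
        congr 1
        ring

theorem IsMaxIndep.mem_maxIndepIn_univ {V : Type*} [Fintype V] [DecidableEq V]
    {G : SimpleGraph V} {s : Finset V} (hs : IsMaxIndep G s) :
    s ∈ maxIndepIn G Finset.univ := by
  refine mem_maxIndepIn.2 ⟨Finset.subset_univ s, hs.1, fun v _ hv => ?_⟩
  by_contra! h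
  refine hs.2 v hv fun x hx y hy hxy => ?_
  rcases Finset.mem_insert.1 hx with rfl | hx' <;> rcases Finset.mem_insert.1 hy with rfl | hy'
  · exact G.irrefl hxy
  · exact h y hy' hxy.symm
  · exact h x hx' hxy
  · exact hs.1 x hx' y hy' hxy

theorem stmt7 (V : Type*) [Fintype V] [DecidableEq V] (G : SimpleGraph V) :
    (MIS G : ℝ) ≤ (3 : ℝ) ^ ((Fintype.card V : ℝ) / 3) := by
  refine le_trans ?_ (card_maxIndepIn_le G Finset.univ)
  have h := Set.ncard_le_ncard (s := {s : Finset V | IsMaxIndep G s})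
    (t := (maxIndepIn G Finset.univ : Set (Finset V)))
    (fun s hs => IsMaxIndep.mem_maxIndepIn_univ hs) (Finset.finite_toSet _)
  rw [Set.ncard_coe_finset] at h
  exact_mod_cast h
end

section
/- For every integer k ≥ 1 and every ε > 0 there exists D such that the following holds for every n: if G is a finite simple graph on n vertices with minimum degree δ(G) ≥ D and maximum degree Δ(G) ≤ k·δ(G), then MIS(G) ≤ 3^{(k/(k+1))·(n/3) + εn}. -/
open Classical in
/-- The maximal independent sets of the subgraph of `G` induced on `A`. -/
noncomputable def misWithin {V : Type*} (G : SimpleGraph V) (A : Finset V) :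
    Finset (Finset V) :=
  {s ∈ A.powerset | IsIndep G s ∧ ∀ v ∈ A, v ∉ s → ∃ u ∈ s, G.Adj v u}

open Classical in
/-- The neighbours of `v` in `A`. -/
noncomputable def nbrsWithin {V : Type*} (G : SimpleGraph V) (A : Finset V) (v : V) : Finset V :=
  {u ∈ A | G.Adj v u}

open Classical in
/-- The vertices of `A` outside the closed neighbourhood of `v`. -/
noncomputable def nonNbrsWithin {V : Type*} (G : SimpleGraph V) (A : Finset V) (v : V) :
    Finset V :=
  {u ∈ A | u ≠ v ∧ ¬ G.Adj v u}

section

variable {V : Type*} (G : SimpleGraph V)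

theorem mem_misWithin {A s : Finset V} :
    s ∈ misWithin G A ↔
      s ⊆ A ∧ IsIndep G s ∧ ∀ v ∈ A, v ∉ s → ∃ u ∈ s, G.Adj v u := by
  simp [misWithin]

theorem mem_nbrsWithin {A : Finset V} {u v : V} : u ∈ nbrsWithin G A v ↔ u ∈ A ∧ G.Adj v u := by
  simp [nbrsWithin]

theorem mem_nonNbrsWithin {A : Finset V} {u v : V} :
    u ∈ nonNbrsWithin G A v ↔ u ∈ A ∧ u ≠ v ∧ ¬ G.Adj v u := by
  simp [nonNbrsWithin]

theorem nonNbrsWithin_ssubset {A : Finset V} {v : V} (hv : v ∈ A) : nonNbrsWithin G A v ⊂ A :=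
  (Finset.ssubset_iff_of_subset fun _ hu => ((mem_nonNbrsWithin G).1 hu).1).2
    ⟨v, hv, by simp [mem_nonNbrsWithin]⟩

theorem isMaxIndep_iff_mem_misWithin_univ [Fintype V] [DecidableEq V] (s : Finset V) :
    IsMaxIndep G s ↔ s ∈ misWithin G Finset.univ := by
  rw [mem_misWithin, IsMaxIndep]
  refine ⟨fun ⟨h, hmax⟩ => ⟨Finset.subset_univ _, h, fun v _ hv => ?_⟩,
    fun ⟨_, h, hmax⟩ => ⟨h, fun v hv hi => ?_⟩⟩
  · by_contra! hno
    refine hmax v hv fun x hx y hy hxy => ?_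
    rcases Finset.mem_insert.1 hx with rfl | hxs <;> rcases Finset.mem_insert.1 hy with rfl | hys
    · exact G.irrefl hxy
    · exact hno y hys hxy
    · exact hno x hxs hxy.symm
    · exact h x hxs y hys hxy
  · obtain ⟨u, hu, hvu⟩ := hmax v (Finset.mem_univ v) hv
    exact hi v (Finset.mem_insert_self v s) u (Finset.mem_insert_of_mem hu) hvu

theorem MIS_eq_card_misWithin_univ [Fintype V] [DecidableEq V] :
    MIS G = (misWithin G Finset.univ).card := by
  rw [MIS, ← Set.ncard_coe_finset]
  congr 1
  ext s
  simpa using isMaxIndep_iff_mem_misWithin_univ G s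

theorem card_nonNbrsWithin {A : Finset V} {v : V} (hv : v ∈ A) :
    (nonNbrsWithin G A v).card + ((nbrsWithin G A v).card + 1) = A.card := by
  classical
  have hvn : v ∉ nbrsWithin G A v := by simp [mem_nbrsWithin]
  rw [← Finset.card_insert_of_notMem hvn, ← Finset.card_union_of_disjoint]
  · congr 1
    ext u
    simp only [mem_nonNbrsWithin, mem_nbrsWithin, Finset.mem_union, Finset.mem_insert]
    grind
  · rw [Finset.disjoint_left]
    simp only [mem_nonNbrsWithin, mem_nbrsWithin, Finset.mem_insert]
    grind

theorem card_filter_mem_misWithin_le [DecidableEq V] {A : Finset V} (v : V) :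
    {s ∈ misWithin G A | v ∈ s}.card ≤ (misWithin G (nonNbrsWithin G A v)).card := by
  refine Finset.card_le_card_of_injOn (fun s => s.erase v) (fun s hs => ?_) (fun s hs t ht h => ?_)
  · obtain ⟨hs, hvs⟩ := Finset.mem_filter.1 hs
    obtain ⟨hsA, hi, hmax⟩ := (mem_misWithin G).1 hs
    refine (mem_misWithin G).2 ⟨fun u hu => ?_, fun x hx y hy => ?_, fun w hw hws => ?_⟩
    · obtain ⟨huv, hus⟩ := Finset.mem_erase.1 hu
      exact (mem_nonNbrsWithin G).2 ⟨hsA hus, huv, hi v hvs u hus⟩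
    · exact hi x (Finset.mem_of_mem_erase hx) y (Finset.mem_of_mem_erase hy)
    · obtain ⟨hwA, hwv, hvw⟩ := (mem_nonNbrsWithin G).1 hw
      obtain ⟨u, hu, hwu⟩ := hmax w hwA fun h => hws (Finset.mem_erase.2 ⟨hwv, h⟩)
      refine ⟨u, Finset.mem_erase.2 ⟨?_, hu⟩, hwu⟩
      rintro rfl
      exact hvw hwu.symm
  · have hvs := (Finset.mem_filter.1 hs).2
    have hvt := (Finset.mem_filter.1 ht).2
    rw [← Finset.insert_erase hvs, ← Finset.insert_erase hvt]
    exact congrArg (insert v) h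

theorem card_misWithin_le_add [DecidableEq V] {A : Finset V} (v : V) :
    (misWithin G A).card ≤
      (misWithin G (A.erase v)).card + (misWithin G (nonNbrsWithin G A v)).card := by
  rw [← Finset.card_filter_add_card_filter_not (fun s => v ∈ s), add_comm]
  refine add_le_add (Finset.card_le_card fun s hs => ?_) (card_filter_mem_misWithin_le G v)
  obtain ⟨hs, hvs⟩ := Finset.mem_filter.1 hs
  obtain ⟨hsA, hi, hmax⟩ := (mem_misWithin G).1 hs
  exact (mem_misWithin G).2 ⟨fun u hu => Finset.mem_erase.2 ⟨fun h => hvs (h ▸ hu), hsA hu⟩, hi,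
    fun w hw => hmax w (Finset.mem_of_mem_erase hw)⟩

theorem natCast_le_three_rpow (m : ℕ) : (m : ℝ) ≤ (3 : ℝ) ^ ((m : ℝ) / 3) := by
  have hpow : ∀ m : ℕ, m ^ 3 ≤ 3 ^ m := by
    intro m
    rcases lt_or_ge m 3 with h | h
    · interval_cases m <;> norm_num
    · induction m, h using Nat.le_induction with
      | base => norm_num
      | succ m hm ih =>
        rw [pow_succ 3 m]
        nlinarith [Nat.mul_le_mul hm hm, Nat.mul_le_mul (Nat.mul_le_mul hm hm) hm]
  refine le_of_pow_le_pow_left₀ three_ne_zero (by positivity) ?_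
  rw [← Real.rpow_natCast (3 ^ _) 3, ← Real.rpow_mul (by norm_num)]
  have h : (m : ℝ) / 3 * (3 : ℕ) = m := by push_cast; ring
  rw [h, Real.rpow_natCast]
  exact_mod_cast hpow m

/-- The Moon–Moser bound. -/
theorem card_misWithin_le_three_rpow (A : Finset V) :
    ((misWithin G A).card : ℝ) ≤ (3 : ℝ) ^ ((A.card : ℝ) / 3) := by
  classical
  induction A using Finset.strongInduction with
  | H A ih =>
    rcases A.eq_empty_or_nonempty with rfl | hA
    · have : (misWithin G ∅).card ≤ 1 := by
        refine (Finset.card_filter_le _ _).trans ?_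
        simp
      simpa using this
    obtain ⟨v, hvA, hv⟩ := Finset.exists_min_image A (fun v => (nbrsWithin G A v).card) hA
    set d := (nbrsWithin G A v).card with hd
    set N := insert v (nbrsWithin G A v) with hN
    have hNA : N ⊆ A := Finset.insert_subset hvA (Finset.filter_subset _ _)
    have hNcard : N.card = d + 1 := Finset.card_insert_of_notMem (by simp [mem_nbrsWithin])
    have hcover : misWithin G A ⊆ N.biUnion fun w => {s ∈ misWithin G A | w ∈ s} := by
      intro s hs
      obtain ⟨hsA, -, hmax⟩ := (mem_misWithin G).1 hs
      rw [Finset.mem_biUnion]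
      by_cases hvs : v ∈ s
      · exact ⟨v, Finset.mem_insert_self _ _, Finset.mem_filter.2 ⟨hs, hvs⟩⟩
      · obtain ⟨u, hu, hvu⟩ := hmax v hvA hvs
        exact ⟨u, Finset.mem_insert_of_mem ((mem_nbrsWithin G).2 ⟨hsA hu, hvu⟩),
          Finset.mem_filter.2 ⟨hs, hu⟩⟩
    have hterm : ∀ w ∈ N, ({s ∈ misWithin G A | w ∈ s}.card : ℝ) ≤
        (3 : ℝ) ^ (((A.card : ℝ) - (d + 1 : ℕ)) / 3) := by
      intro w hw
      have hcard := card_nonNbrsWithin G (hNA hw)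
      have hdw : d ≤ _ := hv w (hNA hw)
      have hss : nonNbrsWithin G A w ⊂ A := nonNbrsWithin_ssubset G (hNA hw)
      refine (Nat.cast_le.2 (card_filter_mem_misWithin_le G w)).trans ((ih _ hss).trans ?_)
      refine Real.rpow_le_rpow_of_exponent_le (by norm_num) ?_
      have : ((nonNbrsWithin G A w).card : ℝ) + (d + 1 : ℕ) ≤ A.card := by
        exact_mod_cast (by omega : (nonNbrsWithin G A w).card + (d + 1) ≤ A.card)
      linarith
    calc ((misWithin G A).card : ℝ)
        ≤ ∑ w ∈ N, ({s ∈ misWithin G A | w ∈ s}.card : ℝ) := by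
          exact_mod_cast (Finset.card_le_card hcover).trans Finset.card_biUnion_le
      _ ≤ ∑ w ∈ N, (3 : ℝ) ^ (((A.card : ℝ) - (d + 1 : ℕ)) / 3) := Finset.sum_le_sum hterm
      _ = (d + 1 : ℕ) * (3 : ℝ) ^ (((A.card : ℝ) - (d + 1 : ℕ)) / 3) := by
          rw [Finset.sum_const, hNcard, nsmul_eq_mul]
      _ ≤ (3 : ℝ) ^ (((d + 1 : ℕ) : ℝ) / 3) * (3 : ℝ) ^ (((A.card : ℝ) - (d + 1 : ℕ)) / 3) := by
          gcongr
          exact natCast_le_three_rpow _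
      _ = (3 : ℝ) ^ ((A.card : ℝ) / 3) := by
          rw [← Real.rpow_add (by norm_num)]
          congr 1
          ring

/-- Branching on vertices of degree at least `t`, until only an induced subgraph of maximum degree
below `t` is left. -/
theorem card_misWithin_le_of_low_degree {t : ℕ} {x M : ℝ} (hx : 1 ≤ x)
    (hxt : x ^ t + 1 ≤ x ^ (t + 1))
    (hM : ∀ B : Finset V, (∀ v ∈ B, (nbrsWithin G B v).card < t) → (B.card : ℝ) ≤ M)
    (A : Finset V) :
    ((misWithin G A).card : ℝ) ≤ (3 : ℝ) ^ (M / 3) * x ^ A.card := by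
  classical
  induction A using Finset.strongInduction with
  | H A ih =>
    by_cases hlow : ∀ v ∈ A, (nbrsWithin G A v).card < t
    · calc ((misWithin G A).card : ℝ) ≤ (3 : ℝ) ^ ((A.card : ℝ) / 3) :=
            card_misWithin_le_three_rpow G A
        _ ≤ (3 : ℝ) ^ (M / 3) := by
            refine Real.rpow_le_rpow_of_exponent_le (by norm_num) ?_
            linarith [hM A hlow]
        _ ≤ (3 : ℝ) ^ (M / 3) * x ^ A.card :=
            le_mul_of_one_le_right (by positivity) (one_le_pow₀ hx)
    · push Not at hlow
      obtain ⟨v, hvA, hv⟩ := hlow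
      have hcard := card_nonNbrsWithin G hvA
      obtain ⟨c, hc⟩ : ∃ c, A.card = c + (t + 1) := ⟨A.card - (t + 1), by omega⟩
      have herase : (A.erase v).card = c + t := by rw [Finset.card_erase_of_mem hvA]; omega
      have hnon : (nonNbrsWithin G A v).card ≤ c := by omega
      have h₁ := ih _ (Finset.erase_ssubset hvA)
      have h₂ := ih _ (nonNbrsWithin_ssubset G hvA)
      rw [herase] at h₁
      calc ((misWithin G A).card : ℝ)
          ≤ (misWithin G (A.erase v)).card + (misWithin G (nonNbrsWithin G A v)).card := by
            exact_mod_cast card_misWithin_le_add G v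
        _ ≤ (3 : ℝ) ^ (M / 3) * x ^ (c + t) + (3 : ℝ) ^ (M / 3) * x ^ c := by
            refine add_le_add h₁ (h₂.trans ?_)
            gcongr
        _ = (3 : ℝ) ^ (M / 3) * x ^ c * (x ^ t + 1) := by ring
        _ ≤ (3 : ℝ) ^ (M / 3) * x ^ c * x ^ (t + 1) := by gcongr
        _ = (3 : ℝ) ^ (M / 3) * x ^ A.card := by rw [hc]; ring

/-- Double counting the edges between `B` and its complement. -/
theorem card_mul_minDegree_le [Fintype V] [DecidableRel G.Adj] {t : ℕ} {B : Finset V}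
    (hB : ∀ v ∈ B, (nbrsWithin G B v).card < t) :
    B.card * G.minDegree + B.card * G.maxDegree ≤
      Fintype.card V * G.maxDegree + B.card * t := by
  classical
  have hout : ∀ v ∈ B, G.minDegree ≤ t + (nbrsWithin G Bᶜ v).card := by
    intro v hv
    have h : G.neighborFinset v = nbrsWithin G B v ∪ nbrsWithin G Bᶜ v := by
      ext u
      simp only [SimpleGraph.mem_neighborFinset, mem_nbrsWithin, Finset.mem_union, Finset.mem_compl]
      tauto
    have h₁ := G.minDegree_le_degree v
    rw [← G.card_neighborFinset_eq_degree, h] at h₁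
    have := Finset.card_union_le (nbrsWithin G B v) (nbrsWithin G Bᶜ v)
    have := hB v hv
    omega
  have hin : ∀ v ∈ Bᶜ, (nbrsWithin G B v).card ≤ G.maxDegree := fun v _ => by
    refine le_trans (Finset.card_le_card fun u hu => ?_) (G.degree_le_maxDegree v)
    simpa using ((mem_nbrsWithin G).1 hu).2
  have hcount : ∑ v ∈ B, (nbrsWithin G Bᶜ v).card = ∑ v ∈ Bᶜ, (nbrsWithin G B v).card := by
    convert Finset.sum_card_bipartiteAbove_eq_sum_card_bipartiteBelow (s := B) (t := Bᶜ)
      (fun u v => G.Adj u v) using 3 with v hv v hv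
    all_goals
      ext u
      simp [mem_nbrsWithin, Finset.bipartiteAbove, Finset.bipartiteBelow, G.adj_comm]
  have h₁ := Finset.sum_le_sum hout
  have h₂ := Finset.sum_le_sum hin
  rw [Finset.sum_add_distrib, hcount] at h₁
  simp only [Finset.sum_const, smul_eq_mul] at h₁ h₂
  have h₃ := B.card_add_card_compl
  rw [← h₃, add_mul]
  omega

end

theorem stmt9 (k : ℕ) (hk : 1 ≤ k) (ε : ℝ) (hε : 0 < ε) :
    ∃ D : ℕ, ∀ (V : Type) [Fintype V] [DecidableEq V]
      (G : SimpleGraph V) [DecidableRel G.Adj],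
      D ≤ G.minDegree → G.maxDegree ≤ k * G.minDegree →
      (MIS G : ℝ) ≤
        (3 : ℝ) ^ ((k : ℝ) / (k + 1) * ((Fintype.card V : ℝ) / 3) + ε * Fintype.card V) := by
  set x : ℝ := (3 : ℝ) ^ (ε / 2) with hx
  have hx1 : 1 < x := Real.one_lt_rpow (by norm_num) (by positivity)
  obtain ⟨t, ht⟩ := pow_unbounded_of_one_lt (x - 1)⁻¹ hx1
  have hxt : x ^ t + 1 ≤ x ^ (t + 1) := by
    rw [inv_lt_iff_one_lt_mul₀ (by linarith)] at ht
    rw [pow_succ]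
    linarith
  obtain ⟨D, hD⟩ := exists_nat_gt (t / ε)
  refine ⟨D, fun V _ _ G _ hmin hmax => ?_⟩
  set n : ℝ := (Fintype.card V : ℝ) with hn
  set δ : ℝ := (G.minDegree : ℝ) with hδdef
  have hδ : t / ε < δ := hD.trans_le (Nat.cast_le.2 hmin)
  have hδ0 : 0 < δ := lt_of_le_of_lt (by positivity) hδ
  have htδ : (t : ℝ) ≤ ε * δ := by
    rw [div_lt_iff₀ hε] at hδ
    linarith
  have hM : ∀ B : Finset V, (∀ v ∈ B, (nbrsWithin G B v).card < t) →
      (B.card : ℝ) ≤ k / (k + 1) * n + ε * n := by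
    intro B hB
    have hBn : (B.card : ℝ) ≤ n := Nat.cast_le.2 B.card_le_univ
    have h : (B.card : ℝ) * δ + B.card * G.maxDegree ≤ n * G.maxDegree + B.card * t := by
      rw [hn, hδdef]
      exact_mod_cast card_mul_minDegree_le G hB
    have hmax' : (G.maxDegree : ℝ) ≤ k * δ := by
      rw [hδdef]
      exact_mod_cast hmax
    have h₁ : (n - B.card) * G.maxDegree ≤ (n - B.card) * (k * δ) :=
      mul_le_mul_of_nonneg_left hmax' (by linarith)
    have h₂ : (B.card : ℝ) * t ≤ n * (ε * δ) := by gcongr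
    have h₃ : (B.card : ℝ) * (k + 1) ≤ k * n + ε * n := by
      refine le_of_mul_le_mul_right ?_ hδ0
      linarith
    have h₄ : ε * n ≤ ε * n * (k + 1) :=
      le_mul_of_one_le_right (by positivity) (by simp)
    rw [div_mul_eq_mul_div, div_add' _ _ _ (by positivity), le_div_iff₀ (by positivity)]
    linarith
  rw [MIS_eq_card_misWithin_univ]
  refine (card_misWithin_le_of_low_degree G hx1.le hxt hM Finset.univ).trans ?_
  rw [Finset.card_univ, hx, ← Real.rpow_natCast, ← Real.rpow_mul (by norm_num),
    ← Real.rpow_add (by norm_num)]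
  refine Real.rpow_le_rpow_of_exponent_le (by norm_num) ?_
  have : 0 ≤ ε * n := by positivity
  linarith
end
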